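/- arXiv:2107.02237 — 10 statements merged into one kernel-verified Lean document; each statement's English description precedes it below -/
import Mathlib

section
/- Let A ≥ 1 be an integer, let y ∈ [0,1]^A, and let b ∈ argmin_{a} y_a. Let γ ≥ 2A, and define the reweighted inverse-gap-weighting distribution p by p_a = y_b / (A·y_b + γ·(y_a − y_b)) for every a ≠ b (with the convention that a term with zero denominator equals 0) and p_b = 1 − Σ_{a ≠ b} p_a. Then for every f ∈ [0,1]^A and every a* ∈ argmin_a f_a, one has Σ_a p_a (f_a − f_{a*}) ≤ (5A/γ)·Σ_a p_a f_a + 7γ·Σ_a p_a (y_a − f_a)² / (y_a + f_a), where ratios with zero denominator are interpreted as 0. -/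
/-- AM-GM with the triangular discrimination `(y - f) ^ 2 / (y + f)` as the quadratic term. -/
lemma sub_le_mul_triangular_add {y f c : ℝ} (hy : 0 ≤ y) (hf : 0 ≤ f) (hc : 0 < c) :
    |y - f| ≤ c * ((y - f) ^ 2 / (y + f)) + (y + f) / (4 * c) := by
  rcases (add_nonneg hy hf).eq_or_lt with h | h
  · have h1 : y = 0 := by linarith
    have h2 : f = 0 := by linarith
    simp [h1, h2]
  · have key : c * ((y - f) ^ 2 / (y + f)) + (y + f) / (4 * c) - |y - f|
        = (2 * c * |y - f| - (y + f)) ^ 2 / (4 * c * (y + f)) := by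
      rw [← sq_abs (y - f)]
      field_simp
      ring
    have : 0 ≤ (2 * c * |y - f| - (y + f)) ^ 2 / (4 * c * (y + f)) := by positivity
    linarith

lemma le_two_mul_add_triangular {y f : ℝ} (hy : 0 ≤ y) (hf : 0 ≤ f) :
    y ≤ 2 * f + 9 / 8 * ((y - f) ^ 2 / (y + f)) := by
  rcases (add_nonneg hy hf).eq_or_lt with h | h
  · have h1 : y = 0 := by linarith
    have h2 : f = 0 := by linarith
    simp [h1, h2]
  · have key : 2 * f + 9 / 8 * ((y - f) ^ 2 / (y + f)) - y
        = (y - 5 * f) ^ 2 / (8 * (y + f)) := by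
      field_simp
      ring
    have : 0 ≤ (y - 5 * f) ^ 2 / (8 * (y + f)) := by positivity
    linarith

/-- Bound on `m - f` when the action with loss `f` has prediction `y` above `m`. -/
lemma sub_le_div_mul_triangular {m y f : ℝ} (hm : 0 < m) (hf : 0 ≤ f) (hy : m < y) :
    m - f ≤ m / (y - m) * ((y - f) ^ 2 / (y + f)) := by
  have hg : 0 < y - m := by linarith
  have hs : 0 < y + f := by linarith
  rw [div_mul_div_comm, le_div_iff₀ (mul_pos hg hs)]
  have h1 : 0 ≤ (y - m) ^ 2 * f := by positivity
  have h2 : 0 ≤ m * (m - f) ^ 2 := by positivity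
  have h3 : 0 ≤ (m - f) ^ 2 * (y - m) := by positivity
  nlinarith

/-- Bound on the difference of the smallest prediction `m` and the loss `f` of an action played with
probability at least its inverse-gap weight. -/
lemma sub_le_of_igw {A γ m y f q : ℝ} (hA : 1 ≤ A) (hγ : 2 * A ≤ γ) (hm : 0 ≤ m) (hf : 0 ≤ f)
    (hy : m ≤ y) (hq : 0 < m → m / (A * m + γ * (y - m)) ≤ q) (hq0 : 0 ≤ q) :
    m - f ≤ 2 * (γ * (q * ((y - f) ^ 2 / (y + f)))) + A / γ * (3 / 4 * m + 1 / 2 * f) := by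
  have hγ0 : 0 < γ := by linarith
  have hD : 0 ≤ (y - f) ^ 2 / (y + f) := div_nonneg (sq_nonneg _) (by linarith)
  rcases le_or_gt m f with hmf | hfm
  · have : 0 ≤ 2 * (γ * (q * ((y - f) ^ 2 / (y + f)))) + A / γ * (3 / 4 * m + 1 / 2 * f) := by
      positivity
    linarith
  have hm0 : 0 < m := by linarith
  have hq := hq hm0
  have hden : 0 < A * m + γ * (y - m) := by
    have : 0 < A * m := by positivity
    have : 0 ≤ γ * (y - m) := mul_nonneg hγ0.le (by linarith)
    linarith
  rcases le_or_gt (γ * (y - m)) (A * m) with hsmall | hlarge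
  · have hq' : 1 / (2 * A) ≤ q := by
      refine le_trans ?_ hq
      rw [div_le_div_iff₀ (by positivity) hden]
      linarith
    have hgm : y - m ≤ m / 2 := by
      have : γ * (y - m) ≤ γ * (m / 2) := by nlinarith
      exact le_of_mul_le_mul_left this hγ0
    have h := sub_le_mul_triangular_add (y := y) (f := f) (c := γ * (1 / (2 * A))) (by linarith) hf
      (by positivity)
    have h1 : γ * (1 / (2 * A)) * ((y - f) ^ 2 / (y + f))
        ≤ γ * (q * ((y - f) ^ 2 / (y + f))) := by
      rw [mul_assoc]
      gcongr
    have h2 : (y + f) / (4 * (γ * (1 / (2 * A)))) = A / γ * (1 / 2 * (y + f)) := by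
      field_simp
      norm_num
    have h3 : A / γ * (1 / 2 * (y + f)) ≤ A / γ * (3 / 4 * m + 1 / 2 * f) := by
      gcongr
      linarith
    have h4 : 0 ≤ γ * (q * ((y - f) ^ 2 / (y + f))) := by positivity
    linarith [le_abs_self (y - f)]
  · have hg : 0 < y - m := by
      have : 0 < A * m := by positivity
      exact pos_of_mul_pos_right (this.trans hlarge) hγ0.le
    have h := sub_le_div_mul_triangular hm0 hf (by linarith : m < y)
    have h1 : m / (y - m) ≤ 2 * (γ * q) := by
      have : m / (y - m) ≤ 2 * (γ * (m / (A * m + γ * (y - m)))) := by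
        rw [← mul_assoc, mul_div_assoc', div_le_div_iff₀ hg hden]
        nlinarith
      have : γ * (m / (A * m + γ * (y - m))) ≤ γ * q := by gcongr
      linarith
    have h2 := mul_le_mul_of_nonneg_right h1 hD
    have h3 : 0 ≤ A / γ * (3 / 4 * m + 1 / 2 * f) := by positivity
    linarith


/-- First-order per-round inequality for reweighted inverse gap weighting
(Theorem `thm:per_round`). Ratios with zero denominator are `0` by Lean's convention
`x / 0 = 0`. -/
theorem stmt_0 (A : ℕ) (hA : 1 ≤ A) (y : Fin A → ℝ)
    (hy : ∀ a, y a ∈ Set.Icc (0:ℝ) 1)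
    (b : Fin A) (hb : ∀ a, y b ≤ y a)
    (γ : ℝ) (hγ : 2 * A ≤ γ)
    (p : Fin A → ℝ)
    (hp : ∀ a, a ≠ b → p a = y b / (A * y b + γ * (y a - y b)))
    (hpb : p b = 1 - ∑ a ∈ Finset.univ.erase b, p a)
    (f : Fin A → ℝ) (hf : ∀ a, f a ∈ Set.Icc (0:ℝ) 1)
    (astar : Fin A) (hastar : ∀ a, f astar ≤ f a) :
    ∑ a, p a * (f a - f astar)
      ≤ (5 * A / γ) * ∑ a, p a * f a
        + 7 * γ * ∑ a, p a * ((y a - f a) ^ 2 / (y a + f a)) := by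
  have hA1 : (1 : ℝ) ≤ A := by exact_mod_cast hA
  have hA0 : (0 : ℝ) < A := by linarith
  have hγ0 : 0 < γ := by linarith
  have hy0 : ∀ a, 0 ≤ y a := fun a => (hy a).1
  have hf0 : ∀ a, 0 ≤ f a := fun a => (hf a).1
  have hgap : ∀ a, 0 ≤ γ * (y a - y b) := fun a => mul_nonneg hγ0.le (sub_nonneg.2 (hb a))
  have hden : ∀ a, 0 ≤ A * y b + γ * (y a - y b) := fun a =>
    add_nonneg (mul_nonneg hA0.le (hy0 b)) (hgap a)
  have hpA : ∀ a, a ≠ b → p a ≤ 1 / A := by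
    intro a ha
    rw [hp a ha]
    refine div_le_of_le_mul₀ (hden a) (by positivity) ?_
    have h1 : 1 / (A : ℝ) * (A * y b + γ * (y a - y b)) = y b + 1 / A * (γ * (y a - y b)) := by
      field_simp
    have h2 : 0 ≤ 1 / (A : ℝ) * (γ * (y a - y b)) := mul_nonneg (by positivity) (hgap a)
    linarith
  have hpbA : 1 / A ≤ p b := by
    have h := Finset.sum_le_card_nsmul (Finset.univ.erase b) p (1 / A)
      fun a ha => hpA a (Finset.ne_of_mem_erase ha)
    rw [Finset.card_erase_of_mem (Finset.mem_univ b), Finset.card_univ, Fintype.card_fin,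
      nsmul_eq_mul, Nat.cast_sub hA, Nat.cast_one] at h
    have : ((A : ℝ) - 1) * (1 / A) = 1 - 1 / A := by field_simp
    linarith
  have hp0 : ∀ a, 0 ≤ p a := by
    intro a
    by_cases ha : a = b
    · subst ha
      exact le_trans (by positivity) hpbA
    · rw [hp a ha]
      exact div_nonneg (hy0 b) (hden a)
  have hsum : ∑ a, p a = 1 := by
    rw [← Finset.add_sum_erase _ p (Finset.mem_univ b), hpb]
    ring
  have hpgap : ∀ a, p a * (y a - y b) ≤ y b / γ := by
    intro a
    by_cases ha : a = b
    · subst ha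
      rw [sub_self, mul_zero]
      exact div_nonneg (hy0 _) hγ0.le
    · rw [hp a ha, div_mul_eq_mul_div]
      refine div_le_of_le_mul₀ (hden a) (div_nonneg (hy0 b) hγ0.le) ?_
      have h1 : y b / γ * (A * y b + γ * (y a - y b))
          = y b / γ * (A * y b) + y b * (y a - y b) := by
        field_simp
      have h2 : 0 ≤ y b / γ * (A * y b) :=
        mul_nonneg (div_nonneg (hy0 b) hγ0.le) (mul_nonneg hA0.le (hy0 b))
      linarith
  set D : Fin A → ℝ := fun a => (y a - f a) ^ 2 / (y a + f a) with hD
  have hD0 : ∀ a, 0 ≤ D a := fun a => div_nonneg (sq_nonneg _) (add_nonneg (hy0 a) (hf0 a))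
  have hpD0 : ∀ a, 0 ≤ p a * D a := fun a => mul_nonneg (hp0 a) (hD0 a)
  set S := ∑ a, p a * f a
  set Y := ∑ a, p a * y a
  set E := ∑ a, p a * D a
  have hE0 : 0 ≤ E := Finset.sum_nonneg fun a _ => hpD0 a
  have hS0 : 0 ≤ S := Finset.sum_nonneg fun a _ => mul_nonneg (hp0 a) (hf0 a)
  have hmean : ∀ (c : ℝ) (v : Fin A → ℝ), (∀ a, c ≤ v a) → c ≤ ∑ a, p a * v a := by
    intro c v hv
    calc c = ∑ a, p a * c := by rw [← Finset.sum_mul, hsum, one_mul]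
      _ ≤ _ := Finset.sum_le_sum fun a _ => mul_le_mul_of_nonneg_left (hv a) (hp0 a)
  have hbY : y b ≤ Y := hmean _ _ hb
  have hfS : f astar ≤ S := hmean _ _ hastar
  have hY : Y ≤ 2 * S + 9 / 8 * E := by
    rw [Finset.mul_sum, Finset.mul_sum, ← Finset.sum_add_distrib]
    refine Finset.sum_le_sum fun a _ => ?_
    have h := mul_le_mul_of_nonneg_left (le_two_mul_add_triangular (hy0 a) (hf0 a)) (hp0 a)
    linarith
  have hfy : S - Y ≤ γ * E + (Y + S) / (4 * γ) := by
    rw [add_div, Finset.sum_div, Finset.sum_div, Finset.mul_sum, ← Finset.sum_add_distrib,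
      ← Finset.sum_add_distrib, ← Finset.sum_sub_distrib]
    refine Finset.sum_le_sum fun a _ => ?_
    have h := sub_le_mul_triangular_add (hy0 a) (hf0 a) hγ0
    have h' := mul_le_mul_of_nonneg_left ((neg_le_abs _).trans h) (hp0 a)
    calc p a * f a - p a * y a = p a * -(y a - f a) := by ring
      _ ≤ _ := h'
      _ = _ := by simp only [hD]; ring
  have hgaps : Y - y b ≤ A / γ * y b := by
    calc Y - y b = ∑ a, p a * (y a - y b) := by
          simp only [mul_sub, Finset.sum_sub_distrib, ← Finset.sum_mul, hsum, one_mul, Y]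
      _ ≤ ∑ _a : Fin A, y b / γ := Finset.sum_le_sum fun a _ => hpgap a
      _ = A / γ * y b := by simp; ring
  have hbest : y b - f astar ≤ 2 * (γ * E) + A / γ * (3 / 4 * Y + 1 / 2 * S) := by
    have hq : 0 < y b → y b / (A * y b + γ * (y astar - y b)) ≤ p astar := by
      intro hm
      by_cases ha : astar = b
      · rw [ha, sub_self, mul_zero, add_zero]
        refine le_trans (le_of_eq ?_) hpbA
        field_simp
      · exact (hp astar ha).ge
    refine (sub_le_of_igw hA1 hγ (hy0 b) (hf0 astar) (hb astar) hq (hp0 astar)).trans ?_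
    have : p astar * D astar ≤ E :=
      Finset.single_le_sum (fun a _ => hpD0 a) (Finset.mem_univ astar)
    gcongr
  have hr : A / γ ≤ 1 / 2 := by
    rw [div_le_div_iff₀ hγ0 two_pos]
    linarith
  have hr0 : 0 ≤ A / γ := by positivity
  have h4 : (Y + S) / (4 * γ) ≤ A / γ * (1 / 4 * (Y + S)) := by
    have h : (Y + S) / (4 * γ) = 1 / γ * (1 / 4 * (Y + S)) := by field_simp
    rw [h]
    have : 0 ≤ Y := (hy0 b).trans hbY
    gcongr
  have h5 : A / γ * y b ≤ A / γ * Y := by gcongr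
  have h6 : A / γ * Y ≤ A / γ * (2 * S + 9 / 8 * E) := by gcongr
  have h7 : A / γ * E ≤ 1 / 2 * E := by gcongr
  have h8 : 2 * E ≤ γ * E := by
    gcongr
    linarith
  have h9 : 0 ≤ A / γ * S := by positivity
  have hL : ∑ a, p a * (f a - f astar) = S - f astar := by
    simp only [mul_sub, Finset.sum_sub_distrib, ← Finset.sum_mul, hsum, one_mul, S]
  have h10 : 5 * A / γ * S = 5 * (A / γ * S) := by ring
  rw [hL, h10]
  linarith
end

section
/- Let A ≥ 1 be an integer, y ∈ [0,1]^A, b ∈ argmin_a y_a, and γ ≥ 2A. Define p_a = y_b / (A·y_b + γ·(y_a − y_b)) for a ≠ b (with the convention that a term with zero denominator equals 0) and p_b = 1 − Σ_{a ≠ b} p_a. Then for every f ∈ [0,1]^A and every a* ∈ argmin_a f_a, one has y_b − f_{a*} ≤ (A/(4γ))·y_b + 2γ·p_{a*}·(y_{a*} − f_{a*})² / (y_{a*} + f_{a*}), where ratios with zero denominator are interpreted as 0. -/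
/-- A tangent-line lower bound for the ratio `X ^ 2 / Q`. -/
theorem sub_div_four_le_sq_div {X Q : ℝ} (hQ : 0 < Q) : X - Q / 4 ≤ X ^ 2 / Q := by
  rw [le_div_iff₀ hQ]
  nlinarith [sq_nonneg (X - Q / 2)]

/-- The scalar inequality behind the per-round bound: `v` is the smallest prediction, `s` the
prediction at the competitor, `x` the competitor's loss. -/
theorem sub_le_inverse_gap_bound {A γ v x s : ℝ} (hA : 0 < A) (hγ : 2 * A ≤ γ) (hv : 0 < v)
    (hx : 0 ≤ x) (hxv : x ≤ v) (hvs : v ≤ s) :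
    v - x ≤ A / (4 * γ) * v
      + 2 * γ * (v / (A * v + γ * (s - v))) * ((s - x) ^ 2 / (s + x)) := by
  obtain ⟨d, rfl⟩ : ∃ d, s = v + d := ⟨s - v, by ring⟩
  obtain ⟨e, rfl⟩ : ∃ e, x = v - e := ⟨v - x, by ring⟩
  have hd : 0 ≤ d := by linarith
  have he : 0 ≤ e := by linarith
  have hev : e ≤ v := by linarith
  have hγ0 : 0 < γ := by linarith
  have hN : 0 < A * v + γ * d := by positivity
  have hS : 0 < 2 * v + d - e := by linarith
  have hkey : 2 * γ * (v / (A * v + γ * (v + d - v))) *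
      ((v + d - (v - e)) ^ 2 / (v + d + (v - e))) =
      (d + e) ^ 2 / ((A * v + γ * d) * (2 * v + d - e) / (2 * γ * v)) := by
    rw [show v + d - v = d by ring, show v + d - (v - e) = d + e by ring,
      show v + d + (v - e) = 2 * v + d - e by ring]
    field_simp
  rw [hkey, sub_sub_cancel]
  have hQ : 0 < (A * v + γ * d) * (2 * v + d - e) / (2 * γ * v) := by positivity
  have hle : (A * v + γ * d) * (2 * v + d - e) ≤ (A * v + γ * d) * (2 * v + d) :=
    mul_le_mul_of_nonneg_left (by linarith) hN.le
  have hAγ : A * v ≤ γ * v / 2 := by nlinarith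
  rcases le_total d v with h | h
  · have hT := sub_div_four_le_sq_div (X := d + e) hQ
    have hB : (A * v + γ * d) * (2 * v + d - e) / (2 * γ * v) / 4 ≤ d + A / (4 * γ) * v := by
      rw [div_div, div_le_iff₀ (by positivity)]
      have hr : (d + A / (4 * γ) * v) * (2 * γ * v * 4) = 8 * γ * v * d + 2 * A * v ^ 2 := by
        field_simp
        ring
      rw [hr]
      nlinarith [mul_le_mul_of_nonneg_right hAγ hd,
        mul_le_mul_of_nonneg_left h (mul_nonneg hγ0.le hd),
        mul_nonneg (mul_nonneg hγ0.le hv.le) hd]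
    linarith
  · have hB : e ≤ (d + e) ^ 2 / ((A * v + γ * d) * (2 * v + d - e) / (2 * γ * v)) := by
      rw [le_div_iff₀ hQ, mul_div_assoc', div_le_iff₀ (by positivity)]
      have hle' : (A * v + γ * d) * (2 * v + d) ≤ γ * (v / 2 + d) * (2 * v + d) :=
        mul_le_mul_of_nonneg_right (by linarith) (by linarith)
      have hpoly : e * ((v / 2 + d) * (2 * v + d)) ≤ (d + e) ^ 2 * (2 * v) := by
        have hvd : v ^ 2 ≤ d ^ 2 := by gcongr
        nlinarith [mul_le_mul hev hvd (sq_nonneg v) hv.le,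
          mul_le_mul_of_nonneg_right hev (sq_nonneg d),
          mul_nonneg (mul_nonneg he hv.le) hd, mul_nonneg hv.le (sq_nonneg e)]
      calc e * ((A * v + γ * d) * (2 * v + d - e))
          ≤ e * (γ * (v / 2 + d) * (2 * v + d)) :=
            mul_le_mul_of_nonneg_left (hle.trans hle') he
        _ = γ * (e * ((v / 2 + d) * (2 * v + d))) := by ring
        _ ≤ γ * ((d + e) ^ 2 * (2 * v)) := mul_le_mul_of_nonneg_left hpoly hγ0.le
        _ = (d + e) ^ 2 * (2 * γ * v) := by ring
    have : 0 ≤ A / (4 * γ) * v := by positivity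
    linarith


/-- Key lemma for the per-round inequality (Lemma `lem:yb_fa`).
Ratios with zero denominator are `0` by Lean's convention `x / 0 = 0`. -/
theorem stmt_1 (A : ℕ) (hA : 1 ≤ A) (y : Fin A → ℝ)
    (hy : ∀ a, y a ∈ Set.Icc (0:ℝ) 1)
    (b : Fin A) (hb : ∀ a, y b ≤ y a)
    (γ : ℝ) (hγ : 2 * A ≤ γ)
    (p : Fin A → ℝ)
    (hp : ∀ a, a ≠ b → p a = y b / (A * y b + γ * (y a - y b)))
    (hpb : p b = 1 - ∑ a ∈ Finset.univ.erase b, p a)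
    (f : Fin A → ℝ) (hf : ∀ a, f a ∈ Set.Icc (0:ℝ) 1)
    (astar : Fin A) (hastar : ∀ a, f astar ≤ f a) :
    y b - f astar
      ≤ (A / (4 * γ)) * y b
        + 2 * γ * p astar * ((y astar - f astar) ^ 2 / (y astar + f astar)) := by
  have hA' : (0 : ℝ) < A := by exact_mod_cast hA
  have hγ0 : 0 < γ := by linarith
  have hv : 0 ≤ y b := (hy b).1
  have hden : ∀ a, A * y b ≤ A * y b + γ * (y a - y b) := fun a =>
    le_add_of_nonneg_right (mul_nonneg hγ0.le (sub_nonneg.2 (hb a)))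
  have hterm : ∀ a, y b / (A * y b + γ * (y a - y b)) ≤ 1 / A := fun a => by
    rcases hv.eq_or_lt with h | h
    · rw [← h, zero_div]
      positivity
    · rw [div_le_div_iff₀ (lt_of_lt_of_le (by positivity) (hden a)) hA']
      linarith [hden a]
  have hpb' : 1 / (A : ℝ) ≤ p b := by
    have hsum : ∑ a ∈ Finset.univ.erase b, p a ≤ (A - 1) * (1 / A) := by
      calc ∑ a ∈ Finset.univ.erase b, p a ≤ ∑ _a ∈ Finset.univ.erase b, 1 / (A : ℝ) :=
            Finset.sum_le_sum fun a ha => (hp a (Finset.ne_of_mem_erase ha)).trans_le (hterm a)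
        _ = (A - 1) * (1 / A) := by
            rw [Finset.sum_const, Finset.card_erase_of_mem (Finset.mem_univ b), Finset.card_univ,
              Fintype.card_fin, nsmul_eq_mul, Nat.cast_sub hA, Nat.cast_one]
    have : ((A : ℝ) - 1) * (1 / A) = 1 - 1 / A := by field_simp
    linarith
  have hlow : y b / (A * y b + γ * (y astar - y b)) ≤ p astar := by
    by_cases h : astar = b
    · exact (hterm astar).trans (h ▸ hpb')
    · exact (hp astar h).ge
  have hq : 0 ≤ y b / (A * y b + γ * (y astar - y b)) :=
    div_nonneg hv ((mul_nonneg hA'.le hv).trans (hden astar))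
  have hR : 0 ≤ (y astar - f astar) ^ 2 / (y astar + f astar) :=
    div_nonneg (sq_nonneg _) (add_nonneg (hy astar).1 (hf astar).1)
  rcases le_or_gt (y b) (f astar) with h | h
  · have hp0 := hq.trans hlow
    exact (sub_nonpos.2 h).trans (by positivity)
  · refine (sub_le_inverse_gap_bound hA' hγ ((hf astar).1.trans_lt h) (hf astar).1 h.le
      (hb astar)).trans ?_
    gcongr
end

section
/- Let A ≥ 1 be an integer and let p, q ∈ ℝ^A be probability vectors (nonnegative entries summing to 1). Then max_{a} (p_a − q_a)² / ((1 − p_a) + (1 − q_a)) ≤ 4·D_H²(p ‖ q), where ratios with zero denominator are interpreted as 0. -/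
/-- Proposition `prop:hellinger_mult_to_ber`: for probability vectors `p, q`
over a finite set, `max_a (p_a − q_a)² / ((1 − p_a) + (1 − q_a)) ≤ 4·D_H²(p ‖ q)`
(stated as the bound holding for every coordinate `a`). Ratios with zero denominator are
`0` by Lean's convention `x / 0 = 0`. -/
theorem stmt_5 (A : ℕ) (hA : 1 ≤ A) (p q : Fin A → ℝ)
    (hp0 : ∀ a, 0 ≤ p a) (hp1 : ∑ a, p a = 1)
    (hq0 : ∀ a, 0 ≤ q a) (hq1 : ∑ a, q a = 1) :
    ∀ a, (p a - q a) ^ 2 / ((1 - p a) + (1 - q a))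
      ≤ 4 * ((1 / 2) * ∑ b, (Real.sqrt (p b) - Real.sqrt (q b)) ^ 2) := by
  intro a
  have hp : ∑ b ∈ Finset.univ.erase a, p b = 1 - p a := by
    rw [← hp1, ← Finset.add_sum_erase _ p (Finset.mem_univ a)]; ring
  have hq : ∑ b ∈ Finset.univ.erase a, q b = 1 - q a := by
    rw [← hq1, ← Finset.add_sum_erase _ q (Finset.mem_univ a)]; ring
  have hdiff : ∑ b ∈ Finset.univ.erase a, (√(p b) - √(q b)) * (√(p b) + √(q b)) = q a - p a := by
    have h : ∀ b ∈ Finset.univ.erase a,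
        (√(p b) - √(q b)) * (√(p b) + √(q b)) = p b - q b := fun b _ => by
      linear_combination Real.sq_sqrt (hp0 b) - Real.sq_sqrt (hq0 b)
    rw [Finset.sum_congr rfl h, Finset.sum_sub_distrib, hp, hq]
    ring
  have hsum : ∑ b ∈ Finset.univ.erase a, (√(p b) + √(q b)) ^ 2
      ≤ 2 * ((1 - p a) + (1 - q a)) := by
    rw [← hp, ← hq, ← Finset.sum_add_distrib, Finset.mul_sum]
    refine Finset.sum_le_sum fun b _ => ?_
    nlinarith [Real.sq_sqrt (hp0 b), Real.sq_sqrt (hq0 b), sq_nonneg (√(p b) - √(q b))]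
  have hcs := Finset.sum_mul_sq_le_sq_mul_sq (Finset.univ.erase a)
    (fun b => √(p b) - √(q b)) (fun b => √(p b) + √(q b))
  rw [hdiff] at hcs
  have hsub : ∑ b ∈ Finset.univ.erase a, (√(p b) - √(q b)) ^ 2
      ≤ ∑ b, (√(p b) - √(q b)) ^ 2 :=
    Finset.sum_le_sum_of_subset_of_nonneg (Finset.erase_subset _ _)
      fun b _ _ => sq_nonneg _
  have hH : 0 ≤ ∑ b, (√(p b) - √(q b)) ^ 2 := Finset.sum_nonneg fun b _ => sq_nonneg _
  have hden : 0 ≤ (1 - p a) + (1 - q a) := by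
    rw [← hp, ← hq]
    exact add_nonneg (Finset.sum_nonneg fun b _ => hp0 b) (Finset.sum_nonneg fun b _ => hq0 b)
  refine div_le_of_le_mul₀ hden (by positivity) ?_
  have hmul := mul_le_mul hsub hsum (Finset.sum_nonneg fun b _ => sq_nonneg _) hH
  linarith [hcs.trans hmul, sub_sq_comm (p a) (q a)]
end

section
/- Let X be a measurable space equipped with a probability measure μ, let A = {1,…,K} be a finite action set, and let f, f★ : X × A → [0,1] be measurable. Let π_f, π★ : X → A be measurable maps such that for every x, π_f(x) ∈ argmin_a f(x,a) and π★(x) ∈ argmin_a f★(x,a). Define L(π) := ∫ f★(x, π(x)) dμ(x), L★ := L(π★), and Δ := ∫ D_Δ(f★(x,·) ‖ f(x,·)) dμ(x). Then L(π_f) − L★ ≤ 8·√(L★ · Δ) + 17·Δ. -/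
open MeasureTheory

/-- If `(x - y)² ≤ b² (x + y)` and `y ≤ a²`, then `x` exceeds `y` by at most `b² + 3/2 a b`. -/
lemma le_add_of_sq_sub_le {x y a b : ℝ} (ha : 0 ≤ a) (hb : 0 ≤ b) (hya : y ≤ a ^ 2)
    (h : (x - y) ^ 2 ≤ b ^ 2 * (x + y)) : x ≤ y + b ^ 2 + 3 / 2 * (a * b) := by
  by_contra! hlt
  have hab : 0 ≤ a * b := mul_nonneg ha hb
  have hd : b ^ 2 + 3 / 2 * (a * b) < x - y := by linarith
  have hb2 : b ^ 2 * y ≤ b ^ 2 * a ^ 2 := mul_le_mul_of_nonneg_left hya (sq_nonneg b)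
  have hpos : 0 < x - y := by nlinarith [sq_nonneg b]
  have hmul : (b ^ 2 + 3 / 2 * (a * b)) * (3 / 2 * (a * b)) ≤ (x - y) * (x - y - b ^ 2) := by
    apply mul_le_mul <;> linarith
  have hab3 : 0 ≤ b ^ 2 * (a * b) := by positivity
  rcases hab.eq_or_lt with h0 | h0
  · rw [← h0] at hd
    have : 0 < (x - y) * (x - y - b ^ 2) := mul_pos hpos (by linarith)
    have : b ^ 2 * a ^ 2 = 0 := by rw [← mul_pow, mul_comm b a, ← h0]; norm_num
    nlinarith
  · have : 0 < (a * b) ^ 2 := by positivity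
    nlinarith

lemma sq_sub_le_mul_of_div_le {u v δ : ℝ} (hu : 0 ≤ u) (hv : 0 ≤ v)
    (h : (u - v) ^ 2 / (u + v) ≤ δ) : (u - v) ^ 2 ≤ δ * (u + v) := by
  rcases (add_nonneg hu hv).eq_or_lt with h0 | h0
  · have hu0 : u = 0 := by linarith
    have hv0 : v = 0 := by linarith
    simp [hu0, hv0]
  · exact (div_le_iff₀ h0).1 h

lemma sq_sub_div_add_le_one {u v : ℝ} (hu : u ∈ Set.Icc (0 : ℝ) 1) (hv : v ∈ Set.Icc (0 : ℝ) 1) :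
    (u - v) ^ 2 / (u + v) ≤ 1 := by
  obtain ⟨hu0, hu1⟩ := hu
  obtain ⟨hv0, hv1⟩ := hv
  refine div_le_of_le_mul₀ (by linarith) zero_le_one ?_
  nlinarith [mul_nonneg hu0 hv0, mul_nonneg hu0 (sub_nonneg.2 hu1),
    mul_nonneg hv0 (sub_nonneg.2 hv1)]

/-- Pointwise regret bound: `q, q'` are the true and predicted losses of the optimal action,
`p, p'` those of the action that is optimal for the prediction. -/
lemma sub_le_of_sq_sub_le {p q p' q' δ : ℝ} (hq : 0 ≤ q) (hδ : 0 ≤ δ) (hpq : p' ≤ q')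
    (hp : (p - p') ^ 2 ≤ δ * (p + p')) (hq' : (q - q') ^ 2 ≤ δ * (q + q')) :
    p - q ≤ 8 * (√q * √δ) + 17 * δ := by
  have ha := Real.sqrt_nonneg q
  have hb := Real.sqrt_nonneg δ
  have hqa := Real.sq_sqrt hq
  have hδb := Real.sq_sqrt hδ
  set a := √q
  set b := √δ
  have hab : 0 ≤ a * b := mul_nonneg ha hb
  have h1 : q' ≤ q + b ^ 2 + 3 / 2 * (a * b) :=
    le_add_of_sq_sub_le ha hb hqa.ge (by rw [hδb]; linarith [sub_sq_comm q q'])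
  have h2 : p ≤ p' + b ^ 2 + 3 / 2 * ((a + b) * b) :=
    le_add_of_sq_sub_le (add_nonneg ha hb) hb (by nlinarith) (by rw [hδb]; exact hp)
  nlinarith

/-- The integrated form of `r ≤ 2 c √(q δ) + d δ`, by Cauchy-Schwarz. -/
lemma integral_le_sqrt_mul_add {X : Type*} [MeasurableSpace X] {μ : Measure X}
    {r q δ : X → ℝ} {c d : ℝ} (hc : 0 ≤ c) (hr : Integrable r μ) (hq : Integrable q μ)
    (hδ : Integrable δ μ) (hq0 : ∀ x, 0 ≤ q x) (hδ0 : ∀ x, 0 ≤ δ x)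
    (h : ∀ x, r x ≤ 2 * c * (√(q x) * √(δ x)) + d * δ x) :
    ∫ x, r x ∂μ ≤ 2 * c * √((∫ x, q x ∂μ) * ∫ x, δ x ∂μ) + d * ∫ x, δ x ∂μ := by
  have hL : 0 ≤ ∫ x, q x ∂μ := integral_nonneg hq0
  have hD : 0 ≤ ∫ x, δ x ∂μ := integral_nonneg hδ0
  have key : ∀ s : ℝ, 0 ≤ s → s * (∫ x, r x ∂μ) ≤
      c * s ^ 2 * (∫ x, q x ∂μ) + (c + d * s) * ∫ x, δ x ∂μ := by
    intro s hs
    rw [← integral_const_mul, ← integral_const_mul, ← integral_const_mul,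
      ← integral_add (hq.const_mul _) (hδ.const_mul _)]
    refine integral_mono (hr.const_mul _) ((hq.const_mul _).add (hδ.const_mul _)) fun x => ?_
    have h1 := mul_le_mul_of_nonneg_left (h x) hs
    have h2 := mul_nonneg hc (sq_nonneg (s * √(q x) - √(δ x)))
    have h3 := Real.sq_sqrt (hq0 x)
    have h4 := Real.sq_sqrt (hδ0 x)
    have h5 : c * (s * √(q x) - √(δ x)) ^ 2 =
        c * s ^ 2 * q x + c * δ x - s * (2 * c * (√(q x) * √(δ x))) := by
      rw [← h3, ← h4, Real.sqrt_sq (Real.sqrt_nonneg _), Real.sqrt_sq (Real.sqrt_nonneg _)]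
      ring
    dsimp only
    linarith
  set R := ∫ x, r x ∂μ
  set L := ∫ x, q x ∂μ
  set D := ∫ x, δ x ∂μ
  rcases le_total (R - d * D) 0 with hneg | hpos
  · have : 0 ≤ 2 * c * √(L * D) := by positivity
    linarith
  · have hdisc : discrim (c * L) (-(R - d * D)) (c * D) ≤ 0 := by
      refine discrim_le_zero fun s => ?_
      rcases le_total 0 s with hs | hs
      · linarith [key s hs]
      · have h1 : 0 ≤ c * L * (s * s) := mul_nonneg (mul_nonneg hc hL) (mul_self_nonneg s)
        have h2 : 0 ≤ (R - d * D) * -s := mul_nonneg hpos (by linarith)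
        have h3 : 0 ≤ c * D := mul_nonneg hc hD
        linarith
    have hsq : (R - d * D) ^ 2 ≤ (2 * c * √(L * D)) ^ 2 := by
      rw [mul_pow, Real.sq_sqrt (mul_nonneg hL hD)]
      rw [discrim] at hdisc
      linarith
    linarith [abs_le_of_sq_le_sq' hsq (by positivity)]

lemma integrable_of_measurable_of_mem_Icc {X : Type*} [MeasurableSpace X] {μ : Measure X}
    [IsFiniteMeasure μ] {g : X → ℝ} (hg : Measurable g) {C : ℝ}
    (h : ∀ x, g x ∈ Set.Icc 0 C) : Integrable g μ :=
  .of_bound hg.aestronglyMeasurable C <| .of_forall fun x => by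
    rw [Real.norm_of_nonneg (h x).1]
    exact (h x).2

lemma measurable_comp_policy {X A : Type*} [MeasurableSpace X] [MeasurableSpace A] [Countable A]
    [MeasurableSingletonClass A] {g : X → A → ℝ} (hg : ∀ a, Measurable fun x => g x a)
    {π : X → A} (hπ : Measurable π) : Measurable fun x => g x (π x) :=
  (measurable_from_prod_countable_left (f := Function.uncurry g) hg).comp
    (measurable_id.prodMk hπ)

/-- Regret decomposition for the triangular discrimination
(Lemma `lem:triangle_selfbounding`). Ratios with zero denominator are `0` by Lean's
convention `x / 0 = 0`. -/
theorem stmt_6 {X : Type*} [MeasurableSpace X] (μ : Measure X) [IsProbabilityMeasure μ]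
    (K : ℕ) (hK : 1 ≤ K)
    (f fstar : X → Fin K → ℝ)
    (hfm : ∀ a, Measurable fun x => f x a) (hfsm : ∀ a, Measurable fun x => fstar x a)
    (hf : ∀ x a, f x a ∈ Set.Icc (0:ℝ) 1) (hfs : ∀ x a, fstar x a ∈ Set.Icc (0:ℝ) 1)
    (πf πs : X → Fin K) (hπfm : Measurable πf) (hπsm : Measurable πs)
    (hπf : ∀ x a, f x (πf x) ≤ f x a) (hπs : ∀ x a, fstar x (πs x) ≤ fstar x a)
    (Lstar Δ : ℝ)
    (hLstar : Lstar = ∫ x, fstar x (πs x) ∂μ)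
    (hΔ : Δ = ∫ x, ∑ a, (fstar x a - f x a) ^ 2 / (fstar x a + f x a) ∂μ) :
    (∫ x, fstar x (πf x) ∂μ) - Lstar ≤ 8 * Real.sqrt (Lstar * Δ) + 17 * Δ := by
  have term_nonneg : ∀ x a, 0 ≤ (fstar x a - f x a) ^ 2 / (fstar x a + f x a) := fun x a =>
    div_nonneg (sq_nonneg _) (add_nonneg (hfs x a).1 (hf x a).1)
  have hq := integrable_of_measurable_of_mem_Icc (μ := μ)
    (measurable_comp_policy hfsm hπsm) fun x => hfs x (πs x)
  have hp := integrable_of_measurable_of_mem_Icc (μ := μ)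
    (measurable_comp_policy hfsm hπfm) fun x => hfs x (πf x)
  have hδ : Integrable (fun x => ∑ a, (fstar x a - f x a) ^ 2 / (fstar x a + f x a)) μ :=
    integrable_finsetSum _ fun a _ => integrable_of_measurable_of_mem_Icc
      ((((hfsm a).sub (hfm a)).pow_const 2).div ((hfsm a).add (hfm a)))
      fun x => ⟨term_nonneg x a, sq_sub_div_add_le_one (hfs x a) (hf x a)⟩
  have hδ0 : ∀ x, 0 ≤ ∑ a, (fstar x a - f x a) ^ 2 / (fstar x a + f x a) := fun x =>
    Finset.sum_nonneg fun a _ => term_nonneg x a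
  have sq_le : ∀ x b, (fstar x b - f x b) ^ 2 ≤
      (∑ a, (fstar x a - f x a) ^ 2 / (fstar x a + f x a)) * (fstar x b + f x b) := fun x b =>
    sq_sub_le_mul_of_div_le (hfs x b).1 (hf x b).1
      (Finset.single_le_sum (f := fun a => (fstar x a - f x a) ^ 2 / (fstar x a + f x a))
        (fun a _ => term_nonneg x a) (Finset.mem_univ b))
  have main := integral_le_sqrt_mul_add (c := 4) (d := 17) (by norm_num) (hp.sub hq) hq hδ
    (fun x => (hfs x _).1) hδ0 fun x => by
      have := sub_le_of_sq_sub_le (hfs x (πs x)).1 (hδ0 x) (hπf x (πs x))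
        (sq_le x (πf x)) (sq_le x (πs x))
      simp only [Pi.sub_apply]
      linarith
  simp only [Pi.sub_apply] at main
  rw [integral_sub hp hq, ← hLstar, ← hΔ] at main
  linarith
end

section
/- Let Z be a measurable space, let P be a probability measure on Z, and let D, D′ be independent Z-valued random elements each with law P. Let F be a nonempty finite set, let C : F × Z → ℝ be measurable with 0 < E_{D′}[exp(C(f, D′))] < ∞ for every f ∈ F, and let f̂ : Z → F be any measurable estimator. Then E_D[ exp( C(f̂(D), D) − log E_{D′}[exp(C(f̂(D), D′))] − log|F| ) ] ≤ 1. -/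
open MeasureTheory

/-- The symmetrization/exponential-moment inequality `eq:plugin_chernoff`:
`E_D[exp(C(f̂(D), D) − log E_{D′}[exp(C(f̂(D), D′))] − log|F|)] ≤ 1`. -/
theorem stmt_11 {Z F : Type*} [MeasurableSpace Z] [MeasurableSpace F]
    [MeasurableSingletonClass F] [Fintype F] [Nonempty F]
    (P : Measure Z) [IsProbabilityMeasure P]
    (C : F → Z → ℝ) (hC : ∀ f, Measurable (C f))
    (hInt : ∀ f, Integrable (fun z => Real.exp (C f z)) P)
    (hpos : ∀ f, 0 < ∫ z, Real.exp (C f z) ∂P)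
    (fhat : Z → F) (hfhat : Measurable fhat) :
    (∫ z, Real.exp (C (fhat z) z - Real.log (∫ z', Real.exp (C (fhat z) z') ∂P)
        - Real.log (Fintype.card F)) ∂P) ≤ 1 := by
  have hcard : (0 : ℝ) < Fintype.card F := by exact_mod_cast Fintype.card_pos
  have hexp : ∀ f z, Real.exp (C f z - Real.log (∫ z', Real.exp (C f z') ∂P)
      - Real.log (Fintype.card F))
      = Real.exp (C f z) / (∫ z', Real.exp (C f z') ∂P) / Fintype.card F := fun f z => by
    rw [Real.exp_sub, Real.exp_sub, Real.exp_log (hpos f), Real.exp_log hcard]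
  simp only [hexp]
  have hnonneg : ∀ f z,
      0 ≤ Real.exp (C f z) / (∫ z', Real.exp (C f z') ∂P) / Fintype.card F := fun f z =>
    div_nonneg (div_nonneg (Real.exp_pos _).le (hpos f).le) hcard.le
  have hint : ∀ f,
      Integrable (fun z => Real.exp (C f z) / (∫ z', Real.exp (C f z') ∂P) / Fintype.card F) P :=
    fun f => ((hInt f).div_const _).div_const _
  calc
    _ ≤ ∫ z, ∑ f, Real.exp (C f z) / (∫ z', Real.exp (C f z') ∂P) / Fintype.card F ∂P := by
      refine integral_mono_of_nonneg (.of_forall fun z => hnonneg _ z)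
        (integrable_finsetSum _ fun f _ => hint f) (.of_forall fun z => ?_)
      exact Finset.single_le_sum
        (f := fun f => Real.exp (C f z) / (∫ z', Real.exp (C f z') ∂P) / Fintype.card F)
        (fun f _ => hnonneg f z) (Finset.mem_univ (fhat z))
    _ = ∑ _f : F, 1 / (Fintype.card F : ℝ) := by
      rw [integral_finsetSum _ fun f _ => hint f]
      refine Finset.sum_congr rfl fun f _ => ?_
      rw [integral_div, integral_div, div_self (hpos f).ne']
    _ ≤ 1 := by simp [hcard.ne']
end

section
/- Let X be a measurable space, let A = {1,…,K} be a finite action set, and let 𝒟 be a probability distribution over pairs (x, ℓ) with x ∈ X and ℓ ∈ [0,1]^A. Let F be a nonempty finite class of measurable functions X × A → [0,1], and suppose (realizability) there exists f★ ∈ F with f★(x,a) = E_𝒟[ℓ(a) | x] almost surely for every a. Given n i.i.d. samples (x_1,ℓ_1),…,(x_n,ℓ_n) from 𝒟, let f̂_KL ∈ argmin_{f ∈ F} Σ_{i=1}^n Σ_{a} [ℓ_i(a)·log(1/f(x_i,a)) + (1−ℓ_i(a))·log(1/(1−f(x_i,a)))]. Then for every δ ∈ (0,1), with probability at least 1 −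 δ over the samples, E_{x∼𝒟}[ Σ_a (f̂_KL(x,a) − f★(x,a))² / (f̂_KL(x,a) + f★(x,a)) ] ≤ 4·K·(log|F| + log(K/δ)) / n, where ratios with zero denominator are interpreted as 0. -/
open MeasureTheory

/-- Extended-real-valued negative logarithm: `negLogE t = −log t`, with `−log 0 = +∞`
(so that the empirical log loss below is extended-real-valued, with `log 0 = −∞`). -/
noncomputable def negLogE (t : ℝ) : EReal :=
  if t = 0 then ⊤ else ((- Real.log t : ℝ) : EReal)

/-- Empirical (binary) log loss of a regression function `f` on a dataset `D` of `n`
context–loss pairs: `Σ_i Σ_a [ℓ_i(a)·log(1/f(x_i,a)) + (1−ℓ_i(a))·log(1/(1−f(x_i,a)))]`,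
valued in the extended reals (`0 · ∞ = 0`). -/
noncomputable def empLogLoss {X : Type*} (K n : ℕ)
    (D : Fin n → X × (Fin K → ℝ)) (f : X → Fin K → ℝ) : EReal :=
  ∑ i, ∑ a, ((((D i).2 a : ℝ) : EReal) * negLogE (f (D i).1 a)
    + (((1 - (D i).2 a : ℝ)) : EReal) * negLogE (1 - f (D i).1 a))

open ProbabilityTheory
open scoped ENNReal

/-- The summand of the empirical log loss. -/
noncomputable def logLossE (l p : ℝ) : EReal :=
  (l : EReal) * negLogE p + ((1 - l : ℝ) : EReal) * negLogE (1 - p)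

/-- The real-valued log loss; it agrees with `logLossE` when the latter is finite. -/
noncomputable def logLoss (l p : ℝ) : ℝ :=
  l * -Real.log p + (1 - l) * -Real.log (1 - p)

/-- A label `l` is compatible with a prediction `p` when `p` does not exclude `l`. -/
def Compatible (l p : ℝ) : Prop := (p = 0 → l = 0) ∧ (p = 1 → l = 1)

theorem negLogE_nonneg {p : ℝ} (hp : p ∈ Set.Icc (0 : ℝ) 1) : 0 ≤ negLogE p := by
  unfold negLogE
  split_ifs with h
  · exact le_top
  · exact_mod_cast neg_nonneg.2 (Real.log_nonpos hp.1 hp.2)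

theorem logLossE_nonneg {l p : ℝ} (hl : l ∈ Set.Icc (0 : ℝ) 1) (hp : p ∈ Set.Icc (0 : ℝ) 1) :
    0 ≤ logLossE l p := by
  have hp' : 1 - p ∈ Set.Icc (0 : ℝ) 1 := ⟨by linarith [hp.2], by linarith [hp.1]⟩
  exact add_nonneg (mul_nonneg (by exact_mod_cast hl.1) (negLogE_nonneg hp))
    (mul_nonneg (by exact_mod_cast sub_nonneg.2 hl.2) (negLogE_nonneg hp'))

theorem logLossE_eq_coe {l p : ℝ} (h : Compatible l p) : logLossE l p = (logLoss l p : ℝ) := by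
  have key : ∀ m r : ℝ, (r = 0 → m = 0) →
      (m : EReal) * negLogE r = ((m * -Real.log r : ℝ) : EReal) := by
    intro m r hmr
    by_cases hr : r = 0
    · simp [hmr hr]
    · simp only [negLogE, if_neg hr, EReal.coe_mul]
  rw [logLossE, logLoss, key l p h.1, key (1 - l) (1 - p), EReal.coe_add]
  intro h1
  rw [h.2 (by linarith), sub_self]

theorem Compatible.of_logLossE_ne_top {l p : ℝ} (hl : l ∈ Set.Icc (0 : ℝ) 1)
    (hp : p ∈ Set.Icc (0 : ℝ) 1) (h : logLossE l p ≠ ⊤) : Compatible l p := by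
  have hp' : 1 - p ∈ Set.Icc (0 : ℝ) 1 := ⟨by linarith [hp.2], by linarith [hp.1]⟩
  have h1 : 0 ≤ (l : EReal) * negLogE p :=
    mul_nonneg (by exact_mod_cast hl.1) (negLogE_nonneg hp)
  have h2 : 0 ≤ ((1 - l : ℝ) : EReal) * negLogE (1 - p) :=
    mul_nonneg (by exact_mod_cast sub_nonneg.2 hl.2) (negLogE_nonneg hp')
  refine ⟨fun h0 => ?_, fun h0 => ?_⟩
  · by_contra hl0
    refine h ?_
    have hpos : 0 < l := lt_of_le_of_ne hl.1 (Ne.symm hl0)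
    rw [logLossE]
    have : (l : EReal) * negLogE p = ⊤ := by
      rw [negLogE, if_pos h0, EReal.coe_mul_top_of_pos hpos]
    rw [this]
    exact EReal.top_add_of_ne_bot (ne_of_gt (lt_of_lt_of_le EReal.bot_lt_zero h2))
  · by_contra hl0
    refine h ?_
    have hpos : 0 < 1 - l := sub_pos.2 (lt_of_le_of_ne hl.2 hl0)
    rw [logLossE]
    have : ((1 - l : ℝ) : EReal) * negLogE (1 - p) = ⊤ := by
      rw [negLogE, if_pos (by linarith), EReal.coe_mul_top_of_pos hpos]
    rw [this]
    exact EReal.add_top_of_ne_bot (ne_of_gt (lt_of_lt_of_le EReal.bot_lt_zero h1))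

theorem EReal.coe_sum_eq_sum_coe {ι : Type*} (s : Finset ι) (g : ι → ℝ) :
    ((∑ i ∈ s, g i : ℝ) : EReal) = ∑ i ∈ s, (g i : EReal) := by
  classical
  induction s using Finset.induction_on with
  | empty => simp
  | insert a s ha ih => rw [Finset.sum_insert ha, Finset.sum_insert ha, EReal.coe_add, ih]

/-- If the total extended log loss of `p` is at most that of a compatible `q`, then `p` is
compatible as well and the same comparison holds for the real-valued losses. -/
theorem compatible_and_sum_logLoss_le {ι : Type*} (s : Finset ι) {l p q : ι → ℝ}
    (hl : ∀ i ∈ s, l i ∈ Set.Icc (0 : ℝ) 1) (hp : ∀ i ∈ s, p i ∈ Set.Icc (0 : ℝ) 1)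
    (hq : ∀ i ∈ s, Compatible (l i) (q i))
    (h : ∑ i ∈ s, logLossE (l i) (p i) ≤ ∑ i ∈ s, logLossE (l i) (q i)) :
    (∀ i ∈ s, Compatible (l i) (p i)) ∧
      ∑ i ∈ s, logLoss (l i) (p i) ≤ ∑ i ∈ s, logLoss (l i) (q i) := by
  rw [Finset.sum_congr rfl fun i hi => logLossE_eq_coe (hq i hi),
    ← EReal.coe_sum_eq_sum_coe] at h
  have hc : ∀ i ∈ s, Compatible (l i) (p i) := by
    intro i hi
    refine Compatible.of_logLossE_ne_top (hl i hi) (hp i hi) (ne_of_lt ?_)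
    refine lt_of_le_of_lt ((Finset.single_le_sum (f := fun i => logLossE (l i) (p i))
      (fun j hj => logLossE_nonneg (hl j hj) (hp j hj)) hi).trans h) (EReal.coe_lt_top _)
  refine ⟨hc, ?_⟩
  rw [Finset.sum_congr rfl fun i hi => logLossE_eq_coe (hc i hi),
    ← EReal.coe_sum_eq_sum_coe] at h
  exact_mod_cast h

theorem exp_half_logLoss_sub_le {l p q : ℝ} (hl : l ∈ Set.Icc (0 : ℝ) 1)
    (hp : p ∈ Set.Icc (0 : ℝ) 1) (hq : q ∈ Set.Icc (0 : ℝ) 1)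
    (hlp : Compatible l p) (hlq : Compatible l q) :
    Real.exp ((logLoss l q - logLoss l p) / 2) ≤
      l * √(p / q) + (1 - l) * √((1 - p) / (1 - q)) := by
  have key : ∀ m r t : ℝ, 0 ≤ r → 0 ≤ t → (r = 0 → m = 0) → (t = 0 → m = 0) →
      m * Real.exp ((Real.log r - Real.log t) / 2) = m * √(r / t) := by
    intro m r t hr ht hr0 ht0
    rcases eq_or_ne m 0 with hm | hm
    · simp [hm]
    have hr' : 0 < r := lt_of_le_of_ne hr fun h => hm (hr0 h.symm)
    have ht' : 0 < t := lt_of_le_of_ne ht fun h => hm (ht0 h.symm)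
    rw [← Real.log_div hr'.ne' ht'.ne', Real.exp_half, Real.exp_log (div_pos hr' ht')]
  have hconv := convexOn_exp.2 (Set.mem_univ ((Real.log p - Real.log q) / 2))
    (Set.mem_univ ((Real.log (1 - p) - Real.log (1 - q)) / 2)) hl.1 (sub_nonneg.2 hl.2)
    (by ring)
  simp only [smul_eq_mul] at hconv
  rw [key l p q hp.1 hq.1 hlp.1 hlq.1, key (1 - l) (1 - p) (1 - q) (sub_nonneg.2 hp.2)
    (sub_nonneg.2 hq.2) (fun h => by rw [hlp.2 (by linarith), sub_self])
    (fun h => by rw [hlq.2 (by linarith), sub_self])] at hconv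
  refine le_trans (le_of_eq ?_) hconv
  congr 1
  unfold logLoss
  ring

theorem sq_sub_div_add_mem_Icc {p q : ℝ} (hp : p ∈ Set.Icc (0 : ℝ) 1)
    (hq : q ∈ Set.Icc (0 : ℝ) 1) : (p - q) ^ 2 / (p + q) ∈ Set.Icc (0 : ℝ) 1 := by
  obtain ⟨hp0, hp1⟩ := hp
  obtain ⟨hq0, hq1⟩ := hq
  refine ⟨by positivity, div_le_one_of_le₀ ?_ (by positivity)⟩
  nlinarith [mul_nonneg hp0 (sub_nonneg.2 hp1), mul_nonneg hq0 (sub_nonneg.2 hq1),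
    mul_nonneg hp0 hq0]

/-- The Bernoulli affinity is controlled by the triangular discrimination. -/
theorem sqrt_mul_add_sqrt_mul_le {p q : ℝ} (hp : p ∈ Set.Icc (0 : ℝ) 1)
    (hq : q ∈ Set.Icc (0 : ℝ) 1) :
    √(q * p) + √((1 - q) * (1 - p)) ≤ 1 - (p - q) ^ 2 / (p + q) / 4 := by
  have hp' := sub_nonneg.2 hp.2
  have hq' := sub_nonneg.2 hq.2
  rw [Real.sqrt_mul hq.1, Real.sqrt_mul hq']
  have hs := Real.sq_sqrt hp.1
  have ht := Real.sq_sqrt hq.1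
  have hu := Real.sq_sqrt hp'
  have hv := Real.sq_sqrt hq'
  have hdiv : (p - q) ^ 2 / (p + q) ≤ 2 * (√p - √q) ^ 2 := by
    refine div_le_of_le_mul₀ (add_nonneg hp.1 hq.1) (by positivity) ?_
    have : (p - q) ^ 2 = (√p - √q) ^ 2 * (√p + √q) ^ 2 := by
      nth_rewrite 1 [← hs, ← ht]
      ring
    have hpq : p + q = √p ^ 2 + √q ^ 2 := by rw [hs, ht]
    rw [this, hpq]
    nlinarith [mul_nonneg (sq_nonneg (√p - √q)) (sq_nonneg (√p - √q))]
  nlinarith [sq_nonneg (√(1 - p) - √(1 - q))]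

theorem mul_sqrt_div_eq {p q : ℝ} (hq : 0 ≤ q) : q * √(p / q) = √(q * p) := by
  rcases hq.eq_or_lt with rfl | h
  · simp
  nth_rewrite 1 [← Real.sqrt_sq hq]
  rw [← Real.sqrt_mul (sq_nonneg q)]
  congr 1
  field_simp

/-- A function and its conditional expectation given `π` integrate equally against nonnegative
functions of `π`. -/
theorem lintegral_ofReal_mul_comp_eq {Ω X : Type*} [MeasurableSpace Ω] [MeasurableSpace X]
    {μ : Measure Ω} [IsFiniteMeasure μ] {π : Ω → X} (hπ : Measurable π) {u : Ω → ℝ}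
    {v : X → ℝ} (hu : Measurable u) (hv : Measurable v) (hui : Integrable u μ)
    (hvi : Integrable (fun ω => v (π ω)) μ) (hu0 : 0 ≤ᵐ[μ] u) (hv0 : ∀ x, 0 ≤ v x)
    (h : ∀ s, MeasurableSet s → ∫ ω in π ⁻¹' s, u ω ∂μ = ∫ ω in π ⁻¹' s, v (π ω) ∂μ)
    {φ : X → ℝ≥0∞} (hφ : Measurable φ) :
    ∫⁻ ω, ENNReal.ofReal (u ω) * φ (π ω) ∂μ =
      ∫⁻ ω, ENNReal.ofReal (v (π ω)) * φ (π ω) ∂μ := by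
  have hmap : (μ.withDensity fun ω => ENNReal.ofReal (u ω)).map π =
      (μ.withDensity fun ω => ENNReal.ofReal (v (π ω))).map π := by
    ext s hs
    rw [Measure.map_apply hπ hs, Measure.map_apply hπ hs, withDensity_apply _ (hπ hs),
      withDensity_apply _ (hπ hs),
      ← ofReal_integral_eq_lintegral_ofReal hui.integrableOn (ae_restrict_of_ae hu0),
      ← ofReal_integral_eq_lintegral_ofReal hvi.integrableOn
        (Filter.Eventually.of_forall fun ω => hv0 _), h s hs]
  have := congrArg (fun ν => ∫⁻ x, φ x ∂ν) hmap
  rw [lintegral_map hφ hπ, lintegral_map hφ hπ,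
    lintegral_withDensity_eq_lintegral_mul _ (by fun_prop) (by fun_prop),
    lintegral_withDensity_eq_lintegral_mul _ (by fun_prop) (by fun_prop)] at this
  simpa only [Pi.mul_apply] using this

/-- Markov's inequality for a product of i.i.d. nonnegative variables. -/
theorem measure_pi_one_le_prod_le {Ω : Type*} [MeasurableSpace Ω] (μ : Measure Ω)
    [IsProbabilityMeasure μ] (n : ℕ) {G : Ω → ℝ≥0∞} (hG : Measurable G) :
    (Measure.pi fun _ : Fin n => μ) {D | 1 ≤ ∏ i, G (D i)} ≤ (∫⁻ ω, G ω ∂μ) ^ n := by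
  have hind : iIndepFun (fun (i : Fin n) (D : Fin n → Ω) => G (D i))
      (Measure.pi fun _ : Fin n => μ) := iIndepFun_pi fun _ => hG.aemeasurable
  have hintegral := lintegral_prod_eq_prod_lintegral_of_indepFun Finset.univ _ hind
    fun i => hG.comp (measurable_pi_apply i)
  have heval : ∀ i : Fin n, ∫⁻ D, G (D i) ∂(Measure.pi fun _ : Fin n => μ) = ∫⁻ ω, G ω ∂μ :=
    fun i => (measurePreserving_eval (fun _ : Fin n => μ) i).lintegral_comp hG
  simp only [heval, Finset.prod_const, Finset.card_univ, Fintype.card_fin] at hintegral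
  rw [← hintegral]
  simpa using mul_meas_ge_le_lintegral (μ := Measure.pi fun _ : Fin n => μ)
    (f := fun D => ∏ i, G (D i))
    (Finset.measurable_prod _ fun i _ => hG.comp (measurable_pi_apply i)) 1

/-- The action average of the likelihood-ratio surrogate of `f` against `g`. -/
noncomputable def affinityRatio {X : Type*} (K : ℕ) (f g : X → Fin K → ℝ)
    (z : X × (Fin K → ℝ)) : ℝ≥0∞ :=
  ENNReal.ofReal (1 / K) * ∑ a, (ENNReal.ofReal (z.2 a) * ENNReal.ofReal √(f z.1 a / g z.1 a) +
    ENNReal.ofReal (1 - z.2 a) * ENNReal.ofReal √((1 - f z.1 a) / (1 - g z.1 a)))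

theorem measurable_affinityRatio {X : Type*} [MeasurableSpace X] {K : ℕ} {f g : X → Fin K → ℝ}
    (hf : ∀ a, Measurable fun x => f x a) (hg : ∀ a, Measurable fun x => g x a) :
    Measurable (affinityRatio K f g) := by
  unfold affinityRatio
  refine Measurable.const_mul (Finset.measurable_sum _ fun a _ => ?_) _
  have h1 : Measurable fun z : X × (Fin K → ℝ) => f z.1 a := (hf a).comp measurable_fst
  have h2 : Measurable fun z : X × (Fin K → ℝ) => g z.1 a := (hg a).comp measurable_fst
  fun_prop

theorem ofReal_exp_le_affinityRatio {X : Type*} {K : ℕ} (hK : 1 ≤ K) {f g : X → Fin K → ℝ}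
    {z : X × (Fin K → ℝ)} (hl : ∀ a, z.2 a ∈ Set.Icc (0 : ℝ) 1)
    (hf : ∀ a, f z.1 a ∈ Set.Icc (0 : ℝ) 1) (hg : ∀ a, g z.1 a ∈ Set.Icc (0 : ℝ) 1)
    (hcf : ∀ a, Compatible (z.2 a) (f z.1 a)) (hcg : ∀ a, Compatible (z.2 a) (g z.1 a)) :
    ENNReal.ofReal (Real.exp (1 / K * ∑ a,
      (logLoss (z.2 a) (g z.1 a) - logLoss (z.2 a) (f z.1 a)) / 2)) ≤ affinityRatio K f g z := by
  have hK' : (0 : ℝ) < K := by exact_mod_cast hK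
  have hconv := convexOn_exp.map_sum_le (t := Finset.univ) (w := fun _ : Fin K => (1 / K : ℝ))
    (p := fun a => (logLoss (z.2 a) (g z.1 a) - logLoss (z.2 a) (f z.1 a)) / 2)
    (fun _ _ => by positivity) (by simp [hK'.ne']) (fun _ _ => Set.mem_univ _)
  simp only [smul_eq_mul, ← Finset.mul_sum] at hconv
  have hnn : ∀ a, 0 ≤ z.2 a * √(f z.1 a / g z.1 a) := fun a =>
    mul_nonneg (hl a).1 (Real.sqrt_nonneg _)
  have hnn' : ∀ a, 0 ≤ (1 - z.2 a) * √((1 - f z.1 a) / (1 - g z.1 a)) := fun a =>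
    mul_nonneg (sub_nonneg.2 (hl a).2) (Real.sqrt_nonneg _)
  have heq : affinityRatio K f g z = ENNReal.ofReal (1 / K * ∑ a,
      (z.2 a * √(f z.1 a / g z.1 a) + (1 - z.2 a) * √((1 - f z.1 a) / (1 - g z.1 a)))) := by
    rw [affinityRatio, ENNReal.ofReal_mul (by positivity),
      ENNReal.ofReal_sum_of_nonneg fun a _ => add_nonneg (hnn a) (hnn' a)]
    congr 1
    refine Finset.sum_congr rfl fun a _ => ?_
    rw [ENNReal.ofReal_add (hnn a) (hnn' a), ENNReal.ofReal_mul (hl a).1,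
      ENNReal.ofReal_mul (sub_nonneg.2 (hl a).2)]
  rw [heq]
  refine ENNReal.ofReal_le_ofReal (hconv.trans ?_)
  gcongr with a
  exact exp_half_logLoss_sub_le (hl a) (hf a) (hg a) (hcf a) (hcg a)

/-- If `f` has empirical log loss at most that of a compatible `g`, the product of the surrogate
likelihood ratios is at least one. -/
theorem one_le_prod_affinityRatio {X : Type*} {K n : ℕ} (hK : 1 ≤ K) {f g : X → Fin K → ℝ}
    (hf : ∀ x a, f x a ∈ Set.Icc (0 : ℝ) 1) (hg : ∀ x a, g x a ∈ Set.Icc (0 : ℝ) 1)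
    {D : Fin n → X × (Fin K → ℝ)} (hl : ∀ i a, (D i).2 a ∈ Set.Icc (0 : ℝ) 1)
    (hcg : ∀ i a, Compatible ((D i).2 a) (g (D i).1 a))
    (h : empLogLoss K n D f ≤ empLogLoss K n D g) :
    1 ≤ ∏ i, affinityRatio K f g (D i) := by
  have h' : ∑ j : Fin n × Fin K, logLossE ((D j.1).2 j.2) (f (D j.1).1 j.2) ≤
      ∑ j : Fin n × Fin K, logLossE ((D j.1).2 j.2) (g (D j.1).1 j.2) := by
    rw [Fintype.sum_prod_type, Fintype.sum_prod_type]
    exact h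
  obtain ⟨hcf, hsum⟩ := compatible_and_sum_logLoss_le Finset.univ (fun j _ => hl j.1 j.2)
    (fun j _ => hf _ _) (fun j _ => hcg j.1 j.2) h'
  rw [Fintype.sum_prod_type, Fintype.sum_prod_type] at hsum
  have hle : ∏ i, ENNReal.ofReal (Real.exp (1 / K * ∑ a,
      (logLoss ((D i).2 a) (g (D i).1 a) - logLoss ((D i).2 a) (f (D i).1 a)) / 2)) ≤
      ∏ i, affinityRatio K f g (D i) :=
    Finset.prod_le_prod' fun i _ => ofReal_exp_le_affinityRatio hK (hl i) (hf _) (hg _)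
      (fun a => hcf (i, a) (Finset.mem_univ _)) (hcg i)
  refine le_trans ?_ hle
  rw [← ENNReal.ofReal_prod_of_nonneg fun i _ => (Real.exp_pos _).le, ← Real.exp_sum,
    ENNReal.one_le_ofReal, Real.one_le_exp_iff, ← Finset.mul_sum]
  refine mul_nonneg (by positivity) ?_
  simp only [← Finset.sum_div, Finset.sum_sub_distrib]
  linarith

section Realizable

variable {X : Type*} [MeasurableSpace X] {K : ℕ} {𝒟 : Measure (X × (Fin K → ℝ))}
  [IsProbabilityMeasure 𝒟] {f g : X → Fin K → ℝ}

theorem integrable_of_forall_mem_Icc {Ω : Type*} [MeasurableSpace Ω] {μ : Measure Ω}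
    [IsFiniteMeasure μ] {u : Ω → ℝ} (hu : Measurable u) {c : ℝ}
    (h : ∀ᵐ ω ∂μ, u ω ∈ Set.Icc 0 c) : Integrable u μ :=
  Integrable.of_bound hu.aestronglyMeasurable c (h.mono fun ω hω => by
    rw [Real.norm_of_nonneg hω.1]; exact hω.2)

theorem lintegral_label_mul_eq (hl : ∀ᵐ z ∂𝒟, ∀ a, z.2 a ∈ Set.Icc (0 : ℝ) 1)
    (hgm : ∀ a, Measurable fun x => g x a) (hg : ∀ x a, g x a ∈ Set.Icc (0 : ℝ) 1) (a : Fin K)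
    (hreal : ∀ s : Set X, MeasurableSet s →
      ∫ z in Prod.fst ⁻¹' s, z.2 a ∂𝒟 = ∫ z in Prod.fst ⁻¹' s, g z.1 a ∂𝒟)
    {φ : X → ℝ≥0∞} (hφ : Measurable φ) :
    ∫⁻ z, ENNReal.ofReal (z.2 a) * φ z.1 ∂𝒟 = ∫⁻ z, ENNReal.ofReal (g z.1 a) * φ z.1 ∂𝒟 ∧
    ∫⁻ z, ENNReal.ofReal (1 - z.2 a) * φ z.1 ∂𝒟 =
      ∫⁻ z, ENNReal.ofReal (1 - g z.1 a) * φ z.1 ∂𝒟 := by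
  have hum : Measurable fun z : X × (Fin K → ℝ) => z.2 a := by fun_prop
  have hui : Integrable (fun z : X × (Fin K → ℝ) => z.2 a) 𝒟 :=
    integrable_of_forall_mem_Icc hum (hl.mono fun z hz => hz a)
  have hvi : Integrable (fun z : X × (Fin K → ℝ) => g z.1 a) 𝒟 :=
    integrable_of_forall_mem_Icc ((hgm a).comp measurable_fst)
      (Filter.Eventually.of_forall fun z => hg _ _)
  refine ⟨lintegral_ofReal_mul_comp_eq measurable_fst hum (hgm a) hui hvi
    (hl.mono fun z hz => (hz a).1) (fun x => (hg x a).1) hreal hφ, ?_⟩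
  refine lintegral_ofReal_mul_comp_eq (v := fun x => 1 - g x a) measurable_fst
    (hum.const_sub 1) ((hgm a).const_sub 1) ((integrable_const 1).sub hui)
    ((integrable_const 1).sub hvi) (hl.mono fun z hz => sub_nonneg.2 (hz a).2)
    (fun x => sub_nonneg.2 (hg x a).2) (fun s hs => ?_) hφ
  rw [integral_sub (integrable_const 1) hui.integrableOn,
    integral_sub (integrable_const 1) hvi.integrableOn, hreal s hs]

theorem ae_compatible (hl : ∀ᵐ z ∂𝒟, ∀ a, z.2 a ∈ Set.Icc (0 : ℝ) 1)
    (hgm : ∀ a, Measurable fun x => g x a) (hg : ∀ x a, g x a ∈ Set.Icc (0 : ℝ) 1)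
    (hreal : ∀ a : Fin K, ∀ s : Set X, MeasurableSet s →
      ∫ z in Prod.fst ⁻¹' s, z.2 a ∂𝒟 = ∫ z in Prod.fst ⁻¹' s, g z.1 a ∂𝒟) :
    ∀ᵐ z ∂𝒟, ∀ a, Compatible (z.2 a) (g z.1 a) := by
  rw [ae_all_iff]
  intro a
  have hind : ∀ c : ℝ, Measurable ((fun x => g x a) ⁻¹' {c} |>.indicator fun _ => (1 : ℝ≥0∞)) :=
    fun c => measurable_const.indicator (hgm a (measurableSet_singleton c))
  have hum : Measurable fun z : X × (Fin K → ℝ) => z.2 a := by fun_prop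
  have h0 := (lintegral_label_mul_eq hl hgm hg a (hreal a) (hind 0)).1
  have h1 := (lintegral_label_mul_eq hl hgm hg a (hreal a) (hind 1)).2
  have e0 : ∀ z : X × (Fin K → ℝ), ENNReal.ofReal (g z.1 a) *
      ((fun x => g x a) ⁻¹' {0}).indicator (fun _ => (1 : ℝ≥0∞)) z.1 = 0 := by
    intro z
    by_cases h : g z.1 a = 0 <;> simp [h]
  have e1 : ∀ z : X × (Fin K → ℝ), ENNReal.ofReal (1 - g z.1 a) *
      ((fun x => g x a) ⁻¹' {1}).indicator (fun _ => (1 : ℝ≥0∞)) z.1 = 0 := by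
    intro z
    by_cases h : g z.1 a = 1 <;> simp [h]
  simp only [e0, lintegral_zero] at h0
  simp only [e1, lintegral_zero] at h1
  replace h0 := (lintegral_eq_zero_iff
    (hum.ennreal_ofReal.mul ((hind 0).comp measurable_fst))).1 h0
  replace h1 := (lintegral_eq_zero_iff
    ((hum.const_sub 1).ennreal_ofReal.mul ((hind 1).comp measurable_fst))).1 h1
  filter_upwards [hl, h0, h1] with z hz hz0 hz1
  refine ⟨fun h => ?_, fun h => ?_⟩
  · have : z.2 a ≤ 0 := by simpa [h] using hz0
    exact le_antisymm this (hz a).1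
  · have : z.2 a ≥ 1 := by simpa [h] using hz1
    exact le_antisymm (hz a).2 this

theorem lintegral_affinityRatio_le (hK : 1 ≤ K)
    (hl : ∀ᵐ z ∂𝒟, ∀ a, z.2 a ∈ Set.Icc (0 : ℝ) 1)
    (hfm : ∀ a, Measurable fun x => f x a) (hf : ∀ x a, f x a ∈ Set.Icc (0 : ℝ) 1)
    (hgm : ∀ a, Measurable fun x => g x a) (hg : ∀ x a, g x a ∈ Set.Icc (0 : ℝ) 1)
    (hreal : ∀ a : Fin K, ∀ s : Set X, MeasurableSet s →
      ∫ z in Prod.fst ⁻¹' s, z.2 a ∂𝒟 = ∫ z in Prod.fst ⁻¹' s, g z.1 a ∂𝒟) :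
    ∫⁻ z, affinityRatio K f g z ∂𝒟 ≤ ENNReal.ofReal (Real.exp (-
      (∫ x, ∑ a, (f x a - g x a) ^ 2 / (f x a + g x a) ∂(𝒟.map Prod.fst)) / (4 * K))) := by
  have hK' : (0 : ℝ) < K := by exact_mod_cast hK
  have hfm' : ∀ a, Measurable fun z : X × (Fin K → ℝ) => f z.1 a :=
    fun a => (hfm a).comp measurable_fst
  have hgm' : ∀ a, Measurable fun z : X × (Fin K → ℝ) => g z.1 a :=
    fun a => (hgm a).comp measurable_fst
  set χ : X → ℝ := fun x => ∑ a, (f x a - g x a) ^ 2 / (f x a + g x a) with hχ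
  have hχm : Measurable χ := Finset.measurable_sum _ fun a _ =>
    (((hfm a).sub (hgm a)).pow_const 2).div ((hfm a).add (hgm a))
  have hχb : ∀ x, χ x ∈ Set.Icc (0 : ℝ) K := fun x =>
    ⟨Finset.sum_nonneg fun a _ => (sq_sub_div_add_mem_Icc (hf x a) (hg x a)).1, by
      simpa using Finset.sum_le_card_nsmul Finset.univ _ 1
        fun a _ => (sq_sub_div_add_mem_Icc (hf x a) (hg x a)).2⟩
  have hstep : ∫⁻ z, affinityRatio K f g z ∂𝒟 =
      ∫⁻ z, ENNReal.ofReal (1 / K) * ∑ a, (ENNReal.ofReal (g z.1 a) *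
        ENNReal.ofReal √(f z.1 a / g z.1 a) + ENNReal.ofReal (1 - g z.1 a) *
        ENNReal.ofReal √((1 - f z.1 a) / (1 - g z.1 a))) ∂𝒟 := by
    unfold affinityRatio
    rw [lintegral_const_mul _ (by fun_prop), lintegral_const_mul _ (by fun_prop),
      lintegral_finsetSum _ (by fun_prop), lintegral_finsetSum _ (by fun_prop)]
    congr 1
    refine Finset.sum_congr rfl fun a _ => ?_
    rw [lintegral_add_left (by fun_prop), lintegral_add_left (by fun_prop)]
    have hφ : Measurable fun x => ENNReal.ofReal √(f x a / g x a) :=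
      ((hfm a).div (hgm a)).sqrt.ennreal_ofReal
    have hψ : Measurable fun x => ENNReal.ofReal √((1 - f x a) / (1 - g x a)) :=
      (((hfm a).const_sub 1).div ((hgm a).const_sub 1)).sqrt.ennreal_ofReal
    rw [(lintegral_label_mul_eq hl hgm hg a (hreal a) hφ).1,
      (lintegral_label_mul_eq hl hgm hg a (hreal a) hψ).2]
  have hpt : ∀ z : X × (Fin K → ℝ), ENNReal.ofReal (1 / K) * ∑ a, (ENNReal.ofReal (g z.1 a) *
        ENNReal.ofReal √(f z.1 a / g z.1 a) + ENNReal.ofReal (1 - g z.1 a) *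
        ENNReal.ofReal √((1 - f z.1 a) / (1 - g z.1 a))) ≤
      ENNReal.ofReal (1 - χ z.1 / (4 * K)) := by
    intro z
    have hsum : ∑ a, (ENNReal.ofReal (g z.1 a) *
        ENNReal.ofReal √(f z.1 a / g z.1 a) + ENNReal.ofReal (1 - g z.1 a) *
        ENNReal.ofReal √((1 - f z.1 a) / (1 - g z.1 a))) = ENNReal.ofReal (∑ a,
        (√(g z.1 a * f z.1 a) + √((1 - g z.1 a) * (1 - f z.1 a)))) := by
      rw [ENNReal.ofReal_sum_of_nonneg fun a _ => by positivity]
      refine Finset.sum_congr rfl fun a _ => ?_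
      have h0 := (hg z.1 a).1
      have h1 := sub_nonneg.2 (hg z.1 a).2
      rw [← ENNReal.ofReal_mul h0, ← ENNReal.ofReal_mul h1, mul_sqrt_div_eq h0,
        mul_sqrt_div_eq h1, ENNReal.ofReal_add (by positivity) (by positivity)]
    rw [hsum, ← ENNReal.ofReal_mul (by positivity)]
    refine ENNReal.ofReal_le_ofReal ?_
    calc 1 / (K : ℝ) * ∑ a, (√(g z.1 a * f z.1 a) + √((1 - g z.1 a) * (1 - f z.1 a)))
        ≤ 1 / (K : ℝ) * ∑ a, (1 - (f z.1 a - g z.1 a) ^ 2 / (f z.1 a + g z.1 a) / 4) := by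
          gcongr with a
          exact sqrt_mul_add_sqrt_mul_le (hf _ a) (hg _ a)
      _ = 1 - χ z.1 / (4 * K) := by
          rw [Finset.sum_sub_distrib, ← Finset.sum_div]
          simp only [Finset.sum_const, Finset.card_univ, Fintype.card_fin, nsmul_eq_mul, hχ]
          field_simp
  have hχi : Integrable (fun z : X × (Fin K → ℝ) => χ z.1) 𝒟 :=
    integrable_of_forall_mem_Icc (hχm.comp measurable_fst)
      (Filter.Eventually.of_forall fun z => hχb z.1)
  have hnn : ∀ z : X × (Fin K → ℝ), 0 ≤ 1 - χ z.1 / (4 * K) := by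
    intro z
    rw [sub_nonneg, div_le_one (by positivity)]
    linarith [(hχb z.1).2]
  rw [hstep, integral_map measurable_fst.aemeasurable hχm.aestronglyMeasurable]
  refine (lintegral_mono hpt).trans ?_
  have hintegral : Integrable (fun z : X × (Fin K → ℝ) => 1 - χ z.1 / (4 * K)) 𝒟 :=
    (integrable_const 1).sub (hχi.div_const _)
  rw [← ofReal_integral_eq_lintegral_ofReal hintegral
    (Filter.Eventually.of_forall hnn), integral_sub (integrable_const 1) (hχi.div_const _),
    integral_div]
  refine ENNReal.ofReal_le_ofReal ?_
  have := Real.add_one_le_exp (-(∫ z, χ z.1 ∂𝒟) / (4 * K))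
  simp only [integral_const, probReal_univ, smul_eq_mul, mul_one]
  rw [neg_div] at this ⊢
  linarith

end Realizable

/-- Theorem `thm:plugin_chi_squared`: with probability at least `1 − δ`
over `n` i.i.d. samples, every empirical log-loss minimizer `f̂_KL` over a finite
realizable class `F` satisfies
`E_x[Σ_a (f̂(x,a) − f★(x,a))²/(f̂(x,a) + f★(x,a))] ≤ 4K(log|F| + log(K/δ))/n`.
Realizability `f★(x,a) = E[ℓ(a) | x]` is expressed by equality of set integrals over all
events measurable in `x`. Ratios with zero denominator are `0`. -/
theorem stmt_12 {X : Type*} [MeasurableSpace X] (K : ℕ) (hK : 1 ≤ K)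
    (𝒟 : Measure (X × (Fin K → ℝ))) [IsProbabilityMeasure 𝒟]
    (hℓ : ∀ᵐ q ∂𝒟, ∀ a, q.2 a ∈ Set.Icc (0:ℝ) 1)
    (F : Finset (X → Fin K → ℝ)) (hFne : F.Nonempty)
    (hFm : ∀ f ∈ F, ∀ a, Measurable fun x => f x a)
    (hF01 : ∀ f ∈ F, ∀ x a, f x a ∈ Set.Icc (0:ℝ) 1)
    (fstar : X → Fin K → ℝ) (hfstar : fstar ∈ F)
    (hreal : ∀ a : Fin K, ∀ s : Set X, MeasurableSet s →
      ∫ q in Prod.fst ⁻¹' s, q.2 a ∂𝒟 = ∫ q in Prod.fst ⁻¹' s, fstar q.1 a ∂𝒟)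
    (n : ℕ) (hn : 0 < n) (δ : ℝ) (hδ : δ ∈ Set.Ioo (0:ℝ) 1) :
    ENNReal.ofReal (1 - δ) ≤
      (Measure.pi fun _ : Fin n => 𝒟)
        {D | ∀ fhat ∈ F, (∀ g ∈ F, empLogLoss K n D fhat ≤ empLogLoss K n D g) →
          (∫ x, ∑ a, (fhat x a - fstar x a) ^ 2 / (fhat x a + fstar x a)
              ∂(𝒟.map Prod.fst))
            ≤ 4 * K * (Real.log F.card + Real.log (K / δ)) / n} := by
  classical
  obtain ⟨hδ0, hδ1⟩ := hδ
  set P := Measure.pi fun _ : Fin n => 𝒟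
  set S := {D : Fin n → X × (Fin K → ℝ) | ∀ fhat ∈ F,
    (∀ g ∈ F, empLogLoss K n D fhat ≤ empLogLoss K n D g) →
      (∫ x, ∑ a, (fhat x a - fstar x a) ^ 2 / (fhat x a + fstar x a) ∂(𝒟.map Prod.fst))
        ≤ 4 * K * (Real.log F.card + Real.log (K / δ)) / n} with hS
  have hK' : (1 : ℝ) ≤ K := by exact_mod_cast hK
  have hn' : (0 : ℝ) < n := by exact_mod_cast hn
  have hF' : (0 : ℝ) < F.card := by exact_mod_cast hFne.card_pos
  set B := F.filter fun f => 4 * K * (Real.log F.card + Real.log (K / δ)) / n <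
    ∫ x, ∑ a, (f x a - fstar x a) ^ 2 / (f x a + fstar x a) ∂(𝒟.map Prod.fst) with hB
  have hbad : ∀ f ∈ B, P {D | 1 ≤ ∏ i, affinityRatio K f fstar (D i)} ≤
      ENNReal.ofReal (δ / F.card) := by
    intro f hf
    obtain ⟨hfF, hgap⟩ := Finset.mem_filter.1 hf
    refine (measure_pi_one_le_prod_le 𝒟 n
      (measurable_affinityRatio (hFm f hfF) (hFm _ hfstar))).trans ?_
    refine (pow_le_pow_left' (lintegral_affinityRatio_le hK hℓ (hFm f hfF) (hF01 f hfF)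
      (hFm _ hfstar) (hF01 _ hfstar) hreal) n).trans ?_
    rw [← ENNReal.ofReal_pow (Real.exp_pos _).le, ← Real.exp_nat_mul]
    refine ENNReal.ofReal_le_ofReal ?_
    rw [← Real.le_log_iff_exp_le (by positivity), Real.log_div hδ0.ne' hF'.ne']
    rw [div_lt_iff₀ hn', Real.log_div (by positivity) hδ0.ne'] at hgap
    have hlogK := Real.log_nonneg hK'
    rw [mul_div_assoc', div_le_iff₀ (by positivity)]
    nlinarith
  have hae : ∀ᵐ D ∂P, ∀ i, (∀ a, (D i).2 a ∈ Set.Icc (0 : ℝ) 1) ∧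
      ∀ a, Compatible ((D i).2 a) (fstar (D i).1 a) := by
    rw [ae_all_iff]
    intro i
    exact (Measure.quasiMeasurePreserving_eval (fun _ : Fin n => 𝒟) i).ae
      (hℓ.and (ae_compatible hℓ (hFm _ hfstar) (hF01 _ hfstar) hreal))
  have hcompl : P Sᶜ ≤ ENNReal.ofReal δ := by
    calc P Sᶜ ≤ P (⋃ f ∈ B, {D | 1 ≤ ∏ i, affinityRatio K f fstar (D i)}) := by
          refine measure_mono_ae (hae.mono fun D hD hDS => ?_)
          obtain ⟨f, hfF, hmin, hgap⟩ : ∃ f ∈ F,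
              (∀ g ∈ F, empLogLoss K n D f ≤ empLogLoss K n D g) ∧
                4 * K * (Real.log F.card + Real.log (K / δ)) / n <
                  ∫ x, ∑ a, (f x a - fstar x a) ^ 2 / (f x a + fstar x a)
                    ∂(𝒟.map Prod.fst) := by
            by_contra! hcon
            exact hDS hcon
          exact Set.mem_biUnion (Finset.mem_filter.2 ⟨hfF, hgap⟩)
            (one_le_prod_affinityRatio hK (hF01 f hfF) (hF01 _ hfstar) (fun i => (hD i).1)
              (fun i => (hD i).2) (hmin _ hfstar))
      _ ≤ ∑ f ∈ B, P {D | 1 ≤ ∏ i, affinityRatio K f fstar (D i)} :=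
          measure_biUnion_finset_le _ _
      _ ≤ ∑ f ∈ F, ENNReal.ofReal (δ / F.card) :=
          (Finset.sum_le_sum hbad).trans
            (Finset.sum_le_sum_of_subset (Finset.filter_subset _ _))
      _ = ENNReal.ofReal δ := by
          rw [Finset.sum_const, ← ENNReal.ofReal_nsmul, nsmul_eq_mul, mul_div_cancel₀ _ hF'.ne']
  rw [ENNReal.ofReal_sub _ hδ0.le, ENNReal.ofReal_one, tsub_le_iff_right]
  calc (1 : ℝ≥0∞) = P (S ∪ Sᶜ) := by rw [Set.union_compl_self, measure_univ]
    _ ≤ P S + P Sᶜ := measure_union_le _ _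
    _ ≤ P S + ENNReal.ofReal δ := by gcongr
end

section
/- Let X be a measurable space, let A = {1,…,K} be a finite action set, and let 𝒟 be a probability distribution over pairs (x, ℓ) with x ∈ X and ℓ ∈ [0,1]^A. Let F be a nonempty finite class of measurable functions X × A → [0,1], and suppose (realizability) there exists f★ ∈ F with f★(x,a) = E_𝒟[ℓ(a) | x] almost surely for every a. For a policy π : X → A define L(π) := E_𝒟[f★(x, π(x))], and let L★ := L(π★) where π★(x) ∈ argmin_a f★(x,a) for every x. Given n i.i.d. samples, let f̂_KL ∈ argmin_{f ∈ F} Σ_{i=1}^n Σ_a [ℓ_i(a)·log(1/f(x_i,a)) + (1−ℓ_i(a))·log(1/(1−f(x_i,a)))], and let π̂_KL(x) ∈ argmin_a f̂_KL(x,a). Then for every δ ∈ (0,1), with probability at least 1 − δ, L(π̂_KL) − L★ ≤ 16·√( L★ · K·(log|F| + log(K/δ)) / n ) + 68·K·(log|F| + log(K/δ)) / n. -/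
open MeasureTheory

open scoped ENNReal

section LogLoss

theorem coe_mul_negLogE {l p : ℝ} (h : p = 0 → l = 0) :
    (l : EReal) * negLogE p = ((l * -Real.log p : ℝ) : EReal) := by
  unfold negLogE
  split_ifs with hp
  · simp [h hp]
  · rw [EReal.coe_mul]

theorem coe_mul_negLogE_nonneg {l p : ℝ} (hl : 0 ≤ l) (hp : p ∈ Set.Icc (0 : ℝ) 1) :
    0 ≤ (l : EReal) * negLogE p := by
  refine mul_nonneg (EReal.coe_nonneg.2 hl) ?_
  unfold negLogE
  split_ifs
  · exact le_top
  · exact EReal.coe_nonneg.2 (neg_nonneg.2 (Real.log_nonpos hp.1 hp.2))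

theorem eq_zero_of_coe_mul_negLogE_ne_top {l p : ℝ} (hl : 0 ≤ l)
    (h : (l : EReal) * negLogE p ≠ ⊤) (hp : p = 0) : l = 0 := by
  by_contra hne
  apply h
  rw [negLogE, if_pos hp, EReal.coe_mul_top_of_pos (lt_of_le_of_ne hl (Ne.symm hne))]

/-- The prediction `p` charges every label that the soft label `l` charges. -/
def LabelSupported (l p : ℝ) : Prop := (p = 0 → l = 0) ∧ (1 - p = 0 → 1 - l = 0)

/-- Real-valued binary log loss. -/
noncomputable def binLogLoss (l p : ℝ) : ℝ := l * -Real.log p + (1 - l) * -Real.log (1 - p)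

theorem one_sub_mem_Icc {p : ℝ} (hp : p ∈ Set.Icc (0 : ℝ) 1) : 1 - p ∈ Set.Icc (0 : ℝ) 1 :=
  ⟨by linarith [hp.2], by linarith [hp.1]⟩

variable {X : Type*} {K n : ℕ} {D : Fin n → X × (Fin K → ℝ)} {f g : X → Fin K → ℝ}

theorem empLogLoss_eq_coe (h : ∀ i a, LabelSupported ((D i).2 a) (f (D i).1 a)) :
    empLogLoss K n D f = ((∑ i, ∑ a, binLogLoss ((D i).2 a) (f (D i).1 a) : ℝ) : EReal) := by
  have hsum : ∀ (m : ℕ) (u : Fin m → ℝ), ((∑ i, u i : ℝ) : EReal) = ∑ i, (u i : EReal) :=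
    fun m u => map_sum (⟨⟨Real.toEReal, EReal.coe_zero⟩, EReal.coe_add⟩ : ℝ →+ EReal) u _
  unfold empLogLoss binLogLoss
  simp_rw [hsum]
  refine Finset.sum_congr rfl fun i _ => Finset.sum_congr rfl fun a _ => ?_
  rw [coe_mul_negLogE (h i a).1, coe_mul_negLogE (h i a).2, EReal.coe_add]

theorem labelSupported_of_empLogLoss_ne_top
    (hl : ∀ i a, (D i).2 a ∈ Set.Icc (0 : ℝ) 1) (hf : ∀ i a, f (D i).1 a ∈ Set.Icc (0 : ℝ) 1)
    (h : empLogLoss K n D f ≠ ⊤) (i : Fin n) (a : Fin K) :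
    LabelSupported ((D i).2 a) (f (D i).1 a) := by
  have h1 : ∀ i a, 0 ≤ (((D i).2 a : ℝ) : EReal) * negLogE (f (D i).1 a) :=
    fun i a => coe_mul_negLogE_nonneg (hl i a).1 (hf i a)
  have h2 : ∀ i a, 0 ≤ ((1 - (D i).2 a : ℝ) : EReal) * negLogE (1 - f (D i).1 a) :=
    fun i a => coe_mul_negLogE_nonneg (one_sub_mem_Icc (hl i a)).1 (one_sub_mem_Icc (hf i a))
  have hle : (((D i).2 a : ℝ) : EReal) * negLogE (f (D i).1 a)
      + ((1 - (D i).2 a : ℝ) : EReal) * negLogE (1 - f (D i).1 a) ≤ empLogLoss K n D f :=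
    (Finset.single_le_sum
      (f := fun a => (((D i).2 a : ℝ) : EReal) * negLogE (f (D i).1 a)
        + ((1 - (D i).2 a : ℝ) : EReal) * negLogE (1 - f (D i).1 a))
      (fun a _ => add_nonneg (h1 i a) (h2 i a)) (Finset.mem_univ a)).trans
    (Finset.single_le_sum
      (f := fun i => ∑ a, ((((D i).2 a : ℝ) : EReal) * negLogE (f (D i).1 a)
        + ((1 - (D i).2 a : ℝ) : EReal) * negLogE (1 - f (D i).1 a)))
      (fun i _ => Finset.sum_nonneg fun a _ => add_nonneg (h1 i a) (h2 i a))
      (Finset.mem_univ i))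
  have hlt := hle.trans_lt (lt_top_iff_ne_top.2 h)
  exact ⟨eq_zero_of_coe_mul_negLogE_ne_top (hl i a).1
      ((le_add_of_nonneg_right (h2 i a)).trans_lt hlt).ne,
    eq_zero_of_coe_mul_negLogE_ne_top (one_sub_mem_Icc (hl i a)).1
      ((le_add_of_nonneg_left (h1 i a)).trans_lt hlt).ne⟩

theorem sqrt_div_eq_exp {u v : ℝ} (hu : 0 < u) (hv : 0 < v) :
    √(v / u) = Real.exp ((Real.log v - Real.log u) / 2) := by
  rw [Real.exp_half, Real.exp_sub, Real.exp_log hu, Real.exp_log hv]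

theorem exp_half_binLogLoss_sub_le {l p r : ℝ} (hl : l ∈ Set.Icc (0 : ℝ) 1)
    (hp : p ∈ Set.Icc (0 : ℝ) 1) (hr : r ∈ Set.Icc (0 : ℝ) 1)
    (hlp : LabelSupported l p) (hlr : LabelSupported l r) :
    Real.exp ((binLogLoss l p - binLogLoss l r) / 2)
      ≤ l * √(r / p) + (1 - l) * √((1 - r) / (1 - p)) := by
  have hpos : ∀ {q : ℝ}, q ∈ Set.Icc (0 : ℝ) 1 → LabelSupported l q → l ≠ 0 → 0 < q :=
    fun hq h h0 => lt_of_le_of_ne hq.1 fun e => h0 (h.1 e.symm)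
  have hpos' : ∀ {q : ℝ}, q ∈ Set.Icc (0 : ℝ) 1 → LabelSupported l q → 1 - l ≠ 0 → 0 < 1 - q :=
    fun hq h h0 => lt_of_le_of_ne (one_sub_mem_Icc hq).1 fun e => h0 (h.2 e.symm)
  by_cases h0 : l = 0
  · have h1 : 1 - l ≠ 0 := by simp [h0]
    rw [sqrt_div_eq_exp (hpos' hp hlp h1) (hpos' hr hlr h1)]
    simp [h0, binLogLoss, neg_add_eq_sub]
  by_cases h1 : 1 - l = 0
  · rw [sqrt_div_eq_exp (hpos hp hlp h0) (hpos hr hlr h0)]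
    have : l = 1 := by linarith
    simp [this, binLogLoss, neg_add_eq_sub]
  rw [sqrt_div_eq_exp (hpos hp hlp h0) (hpos hr hlr h0),
    sqrt_div_eq_exp (hpos' hp hlp h1) (hpos' hr hlr h1)]
  have := convexOn_exp.2 (Set.mem_univ ((Real.log r - Real.log p) / 2))
    (Set.mem_univ ((Real.log (1 - r) - Real.log (1 - p)) / 2)) hl.1 (one_sub_mem_Icc hl).1
    (by ring)
  simp only [smul_eq_mul] at this
  refine le_trans (le_of_eq ?_) this
  unfold binLogLoss
  congr 1
  ring

/-- Average over the actions of the linearized square-root likelihood ratio of `f` to `g`. -/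
noncomputable def rootRatio (g f : X → Fin K → ℝ) (q : X × (Fin K → ℝ)) : ℝ≥0∞ :=
  ∑ a, (K : ℝ≥0∞)⁻¹ * (ENNReal.ofReal (q.2 a) * ENNReal.ofReal (√(f q.1 a / g q.1 a))
    + ENNReal.ofReal (1 - q.2 a) * ENNReal.ofReal (√((1 - f q.1 a) / (1 - g q.1 a))))

theorem ofReal_exp_le_rootRatio (hK : 1 ≤ K) {q : X × (Fin K → ℝ)}
    (hl : ∀ a, q.2 a ∈ Set.Icc (0 : ℝ) 1)
    (hf : ∀ a, f q.1 a ∈ Set.Icc (0 : ℝ) 1) (hg : ∀ a, g q.1 a ∈ Set.Icc (0 : ℝ) 1)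
    (hsf : ∀ a, LabelSupported (q.2 a) (f q.1 a)) (hsg : ∀ a, LabelSupported (q.2 a) (g q.1 a)) :
    ENNReal.ofReal (Real.exp (∑ a, (K : ℝ)⁻¹ *
      ((binLogLoss (q.2 a) (g q.1 a) - binLogLoss (q.2 a) (f q.1 a)) / 2)))
      ≤ rootRatio g f q := by
  have hK0 : (0 : ℝ) < K := by exact_mod_cast hK
  have hjensen := convexOn_exp.map_sum_le (t := Finset.univ) (w := fun _ : Fin K => (K : ℝ)⁻¹)
    (p := fun a => (binLogLoss (q.2 a) (g q.1 a) - binLogLoss (q.2 a) (f q.1 a)) / 2)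
    (fun _ _ => by positivity) (by simp [hK0.ne']) (fun _ _ => Set.mem_univ _)
  simp only [smul_eq_mul] at hjensen
  refine (ENNReal.ofReal_le_ofReal (hjensen.trans (Finset.sum_le_sum fun a _ =>
    mul_le_mul_of_nonneg_left (exp_half_binLogLoss_sub_le (hl a) (hg a) (hf a) (hsg a) (hsf a))
      (by positivity)))).trans (le_of_eq ?_)
  have hnn : ∀ a, 0 ≤ q.2 a * √(f q.1 a / g q.1 a) := fun a =>
    mul_nonneg (hl a).1 (Real.sqrt_nonneg _)
  have hnn' : ∀ a, 0 ≤ (1 - q.2 a) * √((1 - f q.1 a) / (1 - g q.1 a)) := fun a =>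
    mul_nonneg (one_sub_mem_Icc (hl a)).1 (Real.sqrt_nonneg _)
  rw [ENNReal.ofReal_sum_of_nonneg fun a _ =>
    mul_nonneg (by positivity) (add_nonneg (hnn a) (hnn' a))]
  refine Finset.sum_congr rfl fun a _ => ?_
  rw [ENNReal.ofReal_mul (by positivity), ENNReal.ofReal_add (hnn a) (hnn' a),
    ENNReal.ofReal_mul (hl a).1, ENNReal.ofReal_mul (one_sub_mem_Icc (hl a)).1,
    ENNReal.ofReal_inv_of_pos hK0, ENNReal.ofReal_natCast]

theorem one_le_prod_rootRatio (hK : 1 ≤ K)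
    (hl : ∀ i a, (D i).2 a ∈ Set.Icc (0 : ℝ) 1) (hf : ∀ i a, f (D i).1 a ∈ Set.Icc (0 : ℝ) 1)
    (hg : ∀ i a, g (D i).1 a ∈ Set.Icc (0 : ℝ) 1)
    (hsg : ∀ i a, LabelSupported ((D i).2 a) (g (D i).1 a))
    (hle : empLogLoss K n D f ≤ empLogLoss K n D g) :
    1 ≤ ∏ i, rootRatio g f (D i) := by
  have hsf := labelSupported_of_empLogLoss_ne_top (f := f) hl hf
    (hle.trans_lt (by rw [empLogLoss_eq_coe hsg]; exact EReal.coe_lt_top _)).ne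
  rw [empLogLoss_eq_coe hsg, empLogLoss_eq_coe hsf, EReal.coe_le_coe_iff] at hle
  refine le_trans ?_ (Finset.prod_le_prod' fun i _ =>
    ofReal_exp_le_rootRatio hK (hl i) (hf i) (hg i) (hsf i) (hsg i))
  rw [← ENNReal.ofReal_prod_of_nonneg fun i _ => (Real.exp_pos _).le, ← Real.exp_sum,
    ENNReal.one_le_ofReal, Real.one_le_exp_iff]
  simp_rw [← Finset.mul_sum, ← Finset.sum_div, Finset.sum_sub_distrib]
  have : (0 : ℝ) ≤ (K : ℝ)⁻¹ := by positivity
  exact mul_nonneg this (by linarith)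

end LogLoss

section Conditional

variable {X Y : Type*} [MeasurableSpace X] [MeasurableSpace Y] {μ : Measure (X × Y)}
  {φ : X × Y → ℝ} {p : X → ℝ}

theorem lintegral_ofReal_mul_comp_fst (hφm : Measurable φ) (hpm : Measurable p)
    (hφi : Integrable φ μ) (hpi : Integrable (fun q => p q.1) μ)
    (hφ0 : 0 ≤ᵐ[μ] φ) (hp0 : ∀ x, 0 ≤ p x)
    (h : ∀ s : Set X, MeasurableSet s →
      ∫ q in Prod.fst ⁻¹' s, φ q ∂μ = ∫ q in Prod.fst ⁻¹' s, p q.1 ∂μ)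
    {g : X → ℝ≥0∞} (hg : Measurable g) :
    ∫⁻ q, ENNReal.ofReal (φ q) * g q.1 ∂μ = ∫⁻ q, ENNReal.ofReal (p q.1) * g q.1 ∂μ := by
  have hmap : (μ.withDensity fun q => ENNReal.ofReal (φ q)).map Prod.fst
      = (μ.withDensity fun q => ENNReal.ofReal (p q.1)).map Prod.fst := by
    ext s hs
    have hs' : MeasurableSet (Prod.fst ⁻¹' s : Set (X × Y)) := measurable_fst hs
    rw [Measure.map_apply measurable_fst hs, Measure.map_apply measurable_fst hs,
      withDensity_apply _ hs', withDensity_apply _ hs',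
      ← ofReal_integral_eq_lintegral_ofReal hφi.integrableOn (ae_restrict_of_ae hφ0),
      ← ofReal_integral_eq_lintegral_ofReal hpi.integrableOn
        (Filter.Eventually.of_forall fun q => hp0 q.1), h s hs]
  have key := congrArg (fun ν => ∫⁻ x, g x ∂ν) hmap
  simp only [lintegral_map hg measurable_fst] at key
  rwa [lintegral_withDensity_eq_lintegral_mul _ (by fun_prop) (by fun_prop),
    lintegral_withDensity_eq_lintegral_mul _ (by fun_prop) (by fun_prop)] at key

theorem ae_eq_zero_of_condMean_eq_zero (hpm : Measurable p) (hφi : Integrable φ μ) (hφ0 : 0 ≤ᵐ[μ] φ)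
    (h : ∀ s : Set X, MeasurableSet s →
      ∫ q in Prod.fst ⁻¹' s, φ q ∂μ = ∫ q in Prod.fst ⁻¹' s, p q.1 ∂μ) :
    ∀ᵐ q ∂μ, p q.1 = 0 → φ q = 0 := by
  have hs : MeasurableSet {x | p x = 0} := hpm (measurableSet_singleton 0)
  have hs' : MeasurableSet (Prod.fst ⁻¹' {x | p x = 0} : Set (X × Y)) := measurable_fst hs
  have h0 : ∫ q in Prod.fst ⁻¹' {x | p x = 0}, φ q ∂μ = 0 := by
    rw [h _ hs]
    exact setIntegral_eq_zero_of_forall_eq_zero fun q hq => hq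
  rw [setIntegral_eq_zero_iff_of_nonneg_ae (ae_restrict_of_ae hφ0) hφi.integrableOn] at h0
  exact (ae_restrict_iff' hs').1 h0

end Conditional

section Affinity

/-- Bhattacharyya affinity of two Bernoulli laws. -/
noncomputable def binAffinity (p r : ℝ) : ℝ := √(p * r) + √((1 - p) * (1 - r))

theorem mul_sqrt_div_le {p r : ℝ} (hp : 0 ≤ p) : p * √(r / p) ≤ √(p * r) := by
  rcases hp.eq_or_lt with rfl | h
  · simp
  · refine le_of_eq ?_
    rw [← Real.sqrt_sq hp, ← Real.sqrt_mul (sq_nonneg p), Real.sqrt_sq hp]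
    congr 1
    field_simp

theorem hellinger_sq_eq {p r : ℝ} (hp : p ∈ Set.Icc (0 : ℝ) 1) (hr : r ∈ Set.Icc (0 : ℝ) 1) :
    (√p - √r) ^ 2 + (√(1 - p) - √(1 - r)) ^ 2 = 2 - 2 * binAffinity p r := by
  have hp' := one_sub_mem_Icc hp
  have hr' := one_sub_mem_Icc hr
  unfold binAffinity
  rw [Real.sqrt_mul hp.1, Real.sqrt_mul hp'.1, sub_sq, sub_sq, Real.sq_sqrt hp.1,
    Real.sq_sqrt hr.1, Real.sq_sqrt hp'.1, Real.sq_sqrt hr'.1]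
  ring

theorem binAffinity_nonneg (p r : ℝ) : 0 ≤ binAffinity p r :=
  add_nonneg (Real.sqrt_nonneg _) (Real.sqrt_nonneg _)

theorem binAffinity_le_one {p r : ℝ} (hp : p ∈ Set.Icc (0 : ℝ) 1) (hr : r ∈ Set.Icc (0 : ℝ) 1) :
    binAffinity p r ≤ 1 := by
  nlinarith [hellinger_sq_eq hp hr, sq_nonneg (√p - √r), sq_nonneg (√(1 - p) - √(1 - r))]

theorem sq_sqrt_sub_sqrt_le {p r : ℝ} (hp : p ∈ Set.Icc (0 : ℝ) 1)
    (hr : r ∈ Set.Icc (0 : ℝ) 1) : (√p - √r) ^ 2 ≤ 2 * (1 - binAffinity p r) := by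
  nlinarith [hellinger_sq_eq hp hr, sq_nonneg (√(1 - p) - √(1 - r))]

theorem sub_le_of_sq_sqrt_sub_sqrt_le {p r t S : ℝ} (hp : 0 ≤ p) (hr : 0 ≤ r) (ht : 0 < t)
    (hS : (√p - √r) ^ 2 ≤ S) : p - r ≤ t * p + S / t := by
  have h1 : p - r ≤ 2 * √p * (√p - √r) := by
    nlinarith [Real.sq_sqrt hp, Real.sq_sqrt hr, sq_nonneg (√p - √r)]
  have h2 : 2 * √p * (√p - √r) ≤ t * p + (√p - √r) ^ 2 / t := by
    have h3 : 0 ≤ (t * √p - (√p - √r)) ^ 2 / t := by positivity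
    have h4 : (t * √p - (√p - √r)) ^ 2 / t
        = t * √p ^ 2 - 2 * √p * (√p - √r) + (√p - √r) ^ 2 / t := by
      field_simp
      ring
    rw [h4, Real.sq_sqrt hp] at h3
    linarith
  have h5 : (√p - √r) ^ 2 / t ≤ S / t := by gcongr
  linarith

theorem sub_le_of_sq_sqrt_sub_sqrt_le' {p r t S : ℝ} (hp : 0 ≤ p) (hr : 0 ≤ r) (ht : 0 < t)
    (hS : (√p - √r) ^ 2 ≤ S) : r - p ≤ t * p + S / t + S := by
  have h1 : r - p = 2 * √p * (√r - √p) + (√p - √r) ^ 2 := by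
    nlinarith [Real.sq_sqrt hp, Real.sq_sqrt hr]
  have h2 : 2 * √p * (√r - √p) ≤ t * p + (√p - √r) ^ 2 / t := by
    have h3 : 0 ≤ (t * √p - (√r - √p)) ^ 2 / t := by positivity
    have h4 : (t * √p - (√r - √p)) ^ 2 / t
        = t * √p ^ 2 - 2 * √p * (√r - √p) + (√p - √r) ^ 2 / t := by
      field_simp
      ring
    rw [h4, Real.sq_sqrt hp] at h3
    linarith
  have h5 : (√p - √r) ^ 2 / t ≤ S / t := by gcongr
  linarith

end Affinity

section Concentration

variable {X : Type*} [MeasurableSpace X] {K n : ℕ} {𝒟 : Measure (X × (Fin K → ℝ))}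
  {f g : X → Fin K → ℝ}

theorem measurable_binAffinity {p r : X → ℝ} (hp : Measurable p) (hr : Measurable r) :
    Measurable fun x => binAffinity (p x) (r x) := by
  unfold binAffinity
  fun_prop

theorem measurable_rootRatio (hf : ∀ a, Measurable fun x => f x a)
    (hg : ∀ a, Measurable fun x => g x a) : Measurable (rootRatio g f) := by
  unfold rootRatio
  fun_prop

theorem integrable_of_mem_Icc {α : Type*} [MeasurableSpace α] {μ : Measure α} [IsFiniteMeasure μ]
    {u : α → ℝ} (hm : Measurable u) (h : ∀ᵐ x ∂μ, u x ∈ Set.Icc (0 : ℝ) 1) : Integrable u μ :=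
  Integrable.of_mem_Icc 0 1 hm.aemeasurable h

/-- The regression function `g` is the conditional mean of the losses given the context. -/
structure IsCondMean (𝒟 : Measure (X × (Fin K → ℝ))) (g : X → Fin K → ℝ) : Prop where
  loss_mem : ∀ᵐ q ∂𝒟, ∀ a, q.2 a ∈ Set.Icc (0 : ℝ) 1
  measurable : ∀ a, Measurable fun x => g x a
  mem_Icc : ∀ x a, g x a ∈ Set.Icc (0 : ℝ) 1
  setIntegral_eq : ∀ a : Fin K, ∀ s : Set X, MeasurableSet s →
    ∫ q in Prod.fst ⁻¹' s, q.2 a ∂𝒟 = ∫ q in Prod.fst ⁻¹' s, g q.1 a ∂𝒟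

namespace IsCondMean

theorem loss_nonneg (h : IsCondMean 𝒟 g) (a : Fin K) : 0 ≤ᵐ[𝒟] fun q => q.2 a :=
  h.loss_mem.mono fun _ hq => (hq a).1

theorem one_sub_loss_nonneg (h : IsCondMean 𝒟 g) (a : Fin K) : 0 ≤ᵐ[𝒟] fun q => 1 - q.2 a :=
  h.loss_mem.mono fun _ hq => (one_sub_mem_Icc (hq a)).1

variable [IsProbabilityMeasure 𝒟]

theorem integrable_loss (h : IsCondMean 𝒟 g) (a : Fin K) : Integrable (fun q => q.2 a) 𝒟 :=
  integrable_of_mem_Icc (by fun_prop) (h.loss_mem.mono fun _ hq => hq a)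

theorem integrable_mean (h : IsCondMean 𝒟 g) (a : Fin K) : Integrable (fun q => g q.1 a) 𝒟 :=
  integrable_of_mem_Icc ((h.measurable a).comp measurable_fst)
    (Filter.Eventually.of_forall fun q => h.mem_Icc q.1 a)

theorem setIntegral_one_sub_eq (h : IsCondMean 𝒟 g) (a : Fin K) (s : Set X)
    (hs : MeasurableSet s) :
    ∫ q in Prod.fst ⁻¹' s, (1 - q.2 a) ∂𝒟 = ∫ q in Prod.fst ⁻¹' s, (1 - g q.1 a) ∂𝒟 := by
  rw [integral_sub (integrable_const _) (h.integrable_loss a).integrableOn,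
    integral_sub (integrable_const _) (h.integrable_mean a).integrableOn, h.setIntegral_eq a s hs]

theorem ae_labelSupported (h : IsCondMean 𝒟 g) :
    ∀ᵐ q ∂𝒟, ∀ a, LabelSupported (q.2 a) (g q.1 a) := by
  refine ae_all_iff.2 fun a => ?_
  have hm := h.measurable a
  exact (ae_eq_zero_of_condMean_eq_zero hm (h.integrable_loss a) (h.loss_nonneg a)
    (h.setIntegral_eq a)).and
    (ae_eq_zero_of_condMean_eq_zero (φ := fun q : X × (Fin K → ℝ) => 1 - q.2 a)
      (p := fun x => 1 - g x a) (by fun_prop) ((integrable_const _).sub (h.integrable_loss a))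
      (h.one_sub_loss_nonneg a) (h.setIntegral_one_sub_eq a))

theorem lintegral_rootRatio_le (h : IsCondMean 𝒟 g) (hK : 1 ≤ K)
    (hf : ∀ a, Measurable fun x => f x a) (hf01 : ∀ x a, f x a ∈ Set.Icc (0 : ℝ) 1) :
    ∫⁻ q, rootRatio g f q ∂𝒟
      ≤ ENNReal.ofReal (∫ q, ∑ a, (K : ℝ)⁻¹ * binAffinity (g q.1 a) (f q.1 a) ∂𝒟) := by
  have hK0 : (0 : ℝ) < K := by exact_mod_cast hK
  have hgm := h.measurable
  have hbm : ∀ a, Measurable fun q : X × (Fin K → ℝ) => binAffinity (g q.1 a) (f q.1 a) :=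
    fun a => (measurable_binAffinity (hgm a) (hf a)).comp measurable_fst
  have hbi : ∀ a, Integrable (fun q => binAffinity (g q.1 a) (f q.1 a)) 𝒟 := fun a =>
    integrable_of_mem_Icc (hbm a) (Filter.Eventually.of_forall fun q =>
      ⟨binAffinity_nonneg _ _, binAffinity_le_one (h.mem_Icc q.1 a) (hf01 q.1 a)⟩)
  rw [integral_finsetSum _ fun a _ => (hbi a).const_mul _,
    ENNReal.ofReal_sum_of_nonneg fun a _ => integral_nonneg fun q =>
      mul_nonneg (by positivity) (binAffinity_nonneg _ _)]
  unfold rootRatio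
  rw [lintegral_finsetSum _ fun a _ => by fun_prop]
  refine Finset.sum_le_sum fun a _ => ?_
  rw [integral_const_mul, ENNReal.ofReal_mul (by positivity), ENNReal.ofReal_inv_of_pos hK0,
    ENNReal.ofReal_natCast, lintegral_const_mul _ (by fun_prop)]
  gcongr
  rw [ofReal_integral_eq_lintegral_ofReal (hbi a)
    (Filter.Eventually.of_forall fun q => binAffinity_nonneg _ _),
    lintegral_add_left (by fun_prop)]
  rw [lintegral_ofReal_mul_comp_fst (φ := fun q : X × (Fin K → ℝ) => q.2 a) (p := fun x => g x a)
      (g := fun x => ENNReal.ofReal √(f x a / g x a)) (by fun_prop) (hgm a) (h.integrable_loss a)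
      (h.integrable_mean a) (h.loss_nonneg a) (fun x => (h.mem_Icc x a).1)
      (h.setIntegral_eq a) (by fun_prop),
    lintegral_ofReal_mul_comp_fst (φ := fun q : X × (Fin K → ℝ) => 1 - q.2 a) (p := fun x => 1 - g x a)
      (g := fun x => ENNReal.ofReal √((1 - f x a) / (1 - g x a)))
      (by fun_prop) (by fun_prop) ((integrable_const _).sub (h.integrable_loss a))
      ((integrable_const _).sub (h.integrable_mean a)) (h.one_sub_loss_nonneg a)
      (fun x => (one_sub_mem_Icc (h.mem_Icc x a)).1) (h.setIntegral_one_sub_eq a)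
      (by fun_prop),
    ← lintegral_add_left (by fun_prop)]
  refine lintegral_mono fun q => ?_
  have hp := h.mem_Icc q.1 a
  have hp' := one_sub_mem_Icc hp
  simp only
  rw [← ENNReal.ofReal_mul hp.1, ← ENNReal.ofReal_mul hp'.1, ← ENNReal.ofReal_add
    (mul_nonneg hp.1 (Real.sqrt_nonneg _)) (mul_nonneg hp'.1 (Real.sqrt_nonneg _))]
  exact ENNReal.ofReal_le_ofReal (add_le_add (mul_sqrt_div_le hp.1) (mul_sqrt_div_le hp'.1))

end IsCondMean

variable [IsProbabilityMeasure 𝒟]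

theorem lintegral_prod_pi {α : Type*} [MeasurableSpace α] (μ : Measure α) [IsProbabilityMeasure μ]
    {u : α → ℝ≥0∞} (hu : Measurable u) (n : ℕ) :
    ∫⁻ D, ∏ i, u (D i) ∂(Measure.pi fun _ : Fin n => μ) = (∫⁻ x, u x ∂μ) ^ n := by
  have hind := ProbabilityTheory.iIndepFun_pi (μ := fun _ : Fin n => μ) (X := fun _ => u)
    fun _ => hu.aemeasurable
  have := ProbabilityTheory.lintegral_prod_eq_prod_lintegral_of_indepFun Finset.univ _ hind
    fun i => hu.comp (measurable_pi_apply i)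
  rw [this]
  have h : ∀ i : Fin n, ∫⁻ D, u (D i) ∂(Measure.pi fun _ : Fin n => μ) = ∫⁻ x, u x ∂μ :=
    fun i => (measurePreserving_eval (fun _ : Fin n => μ) i).lintegral_comp hu
  simp [h]

theorem IsCondMean.measure_one_le_prod_rootRatio_le (h : IsCondMean 𝒟 g) (hK : 1 ≤ K)
    (hf : ∀ a, Measurable fun x => f x a) (hf01 : ∀ x a, f x a ∈ Set.Icc (0 : ℝ) 1) (n : ℕ) :
    (Measure.pi fun _ : Fin n => 𝒟) {D | 1 ≤ ∏ i, rootRatio g f (D i)}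
      ≤ ENNReal.ofReal
        ((∫ q, ∑ a, (K : ℝ)⁻¹ * binAffinity (g q.1 a) (f q.1 a) ∂𝒟) ^ n) := by
  have hm := measurable_rootRatio hf h.measurable
  have hmark := mul_meas_ge_le_lintegral (μ := Measure.pi fun _ : Fin n => 𝒟)
    (f := fun D => ∏ i, rootRatio g f (D i)) (by fun_prop) 1
  rw [one_mul, lintegral_prod_pi 𝒟 hm] at hmark
  refine hmark.trans ?_
  rw [ENNReal.ofReal_pow (integral_nonneg fun q => Finset.sum_nonneg fun a _ =>
    mul_nonneg (by positivity) (binAffinity_nonneg _ _))]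
  gcongr
  exact h.lintegral_rootRatio_le hK hf hf01

end Concentration

section Regret

variable {X : Type*} [MeasurableSpace X] {K : ℕ} {f g : X → Fin K → ℝ}

theorem measurable_eval_policy (hg : ∀ a, Measurable fun x => g x a) {π : X → Fin K}
    (hπ : Measurable π) : Measurable fun x => g x (π x) :=
  (measurable_from_prod_countable_left (f := fun q : X × Fin K => g q.1 q.2) hg).comp
    (measurable_id.prodMk hπ)

theorem greedy_regret_le {ν : Measure X} [IsProbabilityMeasure ν] (hK : 1 ≤ K)
    (hf : ∀ a, Measurable fun x => f x a) (hg : ∀ a, Measurable fun x => g x a)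
    (hf01 : ∀ x a, f x a ∈ Set.Icc (0 : ℝ) 1) (hg01 : ∀ x a, g x a ∈ Set.Icc (0 : ℝ) 1)
    {π ρ : X → Fin K} (hπ : Measurable π) (hρ : Measurable ρ) (hle : ∀ x, f x (π x) ≤ f x (ρ x))
    {t : ℝ} (ht : 0 < t) :
    (∫ x, g x (π x) ∂ν) - ∫ x, g x (ρ x) ∂ν
      ≤ t * ((∫ x, g x (π x) ∂ν) + ∫ x, g x (ρ x) ∂ν)
        + (2 / t + 1) * (2 * K * (1 - ∫ x, ∑ a, (K : ℝ)⁻¹ * binAffinity (g x a) (f x a) ∂ν)) := by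
  have hK0 : (0 : ℝ) < K := by exact_mod_cast hK
  have hgi : ∀ {σ : X → Fin K}, Measurable σ → Integrable (fun x => g x (σ x)) ν := fun hσ =>
    integrable_of_mem_Icc (measurable_eval_policy hg hσ)
      (Filter.Eventually.of_forall fun x => hg01 x _)
  have hbi : Integrable (fun x => ∑ a, (K : ℝ)⁻¹ * binAffinity (g x a) (f x a)) ν :=
    integrable_finsetSum _ fun a _ => (integrable_of_mem_Icc (measurable_binAffinity (hg a) (hf a))
      (Filter.Eventually.of_forall fun x =>
        ⟨binAffinity_nonneg _ _, binAffinity_le_one (hg01 x a) (hf01 x a)⟩)).const_mul _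
  have hS : ∀ x a, (√(g x a) - √(f x a)) ^ 2
      ≤ 2 * K * (1 - ∑ a, (K : ℝ)⁻¹ * binAffinity (g x a) (f x a)) := by
    intro x a
    have h1 : 2 * K * (1 - ∑ a, (K : ℝ)⁻¹ * binAffinity (g x a) (f x a))
        = ∑ a, 2 * (1 - binAffinity (g x a) (f x a)) := by
      simp only [← Finset.mul_sum, Finset.sum_sub_distrib, Finset.sum_const, Finset.card_univ,
        Fintype.card_fin, nsmul_eq_mul, mul_one]
      field_simp
    rw [h1]
    exact (sq_sqrt_sub_sqrt_le (hg01 x a) (hf01 x a)).trans (Finset.single_le_sum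
      (f := fun a => 2 * (1 - binAffinity (g x a) (f x a)))
      (fun a _ => by linarith [binAffinity_le_one (hg01 x a) (hf01 x a)]) (Finset.mem_univ a))
  have hpt : ∀ x, g x (π x) - g x (ρ x) ≤ t * (g x (π x) + g x (ρ x))
      + (2 / t + 1) * (2 * K * (1 - ∑ a, (K : ℝ)⁻¹ * binAffinity (g x a) (f x a))) := by
    intro x
    have h1 := sub_le_of_sq_sqrt_sub_sqrt_le (hg01 x (π x)).1 (hf01 x (π x)).1 ht (hS x (π x))
    have h2 := sub_le_of_sq_sqrt_sub_sqrt_le' (hg01 x (ρ x)).1 (hf01 x (ρ x)).1 ht (hS x (ρ x))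
    refine (by linarith [hle x] : g x (π x) - g x (ρ x) ≤ _ + _).trans
      ((add_le_add h1 h2).trans (le_of_eq (by ring)))
  have hR : Integrable (fun x => (2 / t + 1)
      * (2 * K * (1 - ∑ a, (K : ℝ)⁻¹ * binAffinity (g x a) (f x a)))) ν :=
    (((integrable_const 1).sub hbi).const_mul _).const_mul _
  have hL : Integrable (fun x => t * (g x (π x) + g x (ρ x))) ν :=
    ((hgi hπ).add (hgi hρ)).const_mul _
  have := integral_mono ((hgi hπ).sub (hgi hρ)) (hL.add hR) hpt
  simp only [Pi.sub_apply, Pi.add_apply] at this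
  rwa [integral_sub (hgi hπ) (hgi hρ), integral_add hL hR, integral_const_mul, integral_const_mul,
    integral_const_mul, integral_add (hgi hπ) (hgi hρ), integral_sub (integrable_const 1) hbi,
    integral_const, probReal_univ, one_smul] at this

theorem le_sqrt_mul_add_of_forall_le {R L C : ℝ} (hL : 0 ≤ L) (hC : 0 < C)
    (h : ∀ t : ℝ, 0 < t → R ≤ t * (R + 2 * L) + (2 / t + 1) * (2 * C)) :
    R ≤ 16 * √(L * C) + 68 * C := by
  have hs := Real.sqrt_nonneg (L * C)
  have hss := Real.sq_sqrt (mul_nonneg hL hC.le)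
  rcases le_or_gt L (4 * C) with hLC | hLC
  · have h1 := h (1 / 2) (by norm_num)
    norm_num at h1
    linarith
  · have hL0 : 0 < L := by linarith
    have hs0 : 0 < √(L * C) := Real.sqrt_pos.2 (mul_pos hL0 hC)
    have ht := h (√(L * C) / L) (by positivity)
    have e1 : 2 / (√(L * C) / L) * (2 * C) = 4 * √(L * C) := by
      field_simp
      nlinarith
    have e2 : √(L * C) / L * (2 * L) = 2 * √(L * C) := by field_simp
    have h2 : √(L * C) / L ≤ 1 / 2 := by
      rw [div_le_iff₀ hL0]
      refine Real.sqrt_le_iff.2 ⟨by linarith, by nlinarith⟩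
    by_cases hR : R ≤ 0
    · linarith
    have h3 : √(L * C) / L * R ≤ 1 / 2 * R := by
      gcongr
      linarith
    linarith

theorem one_sub_le_log_div {c ε : ℝ} {n : ℕ} (hn : 0 < n) (hε : 0 < ε) (hc : 0 ≤ c)
    (h : ε < c ^ n) : 1 - c ≤ Real.log (1 / ε) / n := by
  have hn0 : (0 : ℝ) < n := by exact_mod_cast hn
  have hc0 : 0 < c := by
    refine hc.lt_of_ne fun e => ?_
    rw [← e, zero_pow hn.ne'] at h
    linarith
  have h1 := Real.log_lt_log hε h
  rw [Real.log_pow] at h1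
  have h2 := Real.log_le_sub_one_of_pos hc0
  rw [le_div_iff₀ hn0, one_div, Real.log_inv]
  nlinarith

end Regret

/-- Theorem `thm:plugin_main` (first-order regret for plug-in
classification with the log loss): with probability at least `1 − δ` over `n` i.i.d.
samples, every empirical log-loss minimizer `f̂_KL` and every measurable greedy policy
`π̂_KL` induced by it satisfy
`L(π̂_KL) − L★ ≤ 16·√(L★·K(log|F| + log(K/δ))/n) + 68·K(log|F| + log(K/δ))/n`.
Realizability `f★(x,a) = E[ℓ(a) | x]` is expressed by equality of set integrals over all
events measurable in `x`. -/
theorem stmt_13 {X : Type*} [MeasurableSpace X] (K : ℕ) (hK : 1 ≤ K)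
    (𝒟 : Measure (X × (Fin K → ℝ))) [IsProbabilityMeasure 𝒟]
    (hℓ : ∀ᵐ q ∂𝒟, ∀ a, q.2 a ∈ Set.Icc (0:ℝ) 1)
    (F : Finset (X → Fin K → ℝ)) (hFne : F.Nonempty)
    (hFm : ∀ f ∈ F, ∀ a, Measurable fun x => f x a)
    (hF01 : ∀ f ∈ F, ∀ x a, f x a ∈ Set.Icc (0:ℝ) 1)
    (fstar : X → Fin K → ℝ) (hfstar : fstar ∈ F)
    (hreal : ∀ a : Fin K, ∀ s : Set X, MeasurableSet s →
      ∫ q in Prod.fst ⁻¹' s, q.2 a ∂𝒟 = ∫ q in Prod.fst ⁻¹' s, fstar q.1 a ∂𝒟)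
    (πstar : X → Fin K) (hπsm : Measurable πstar)
    (hπs : ∀ x a, fstar x (πstar x) ≤ fstar x a)
    (n : ℕ) (hn : 0 < n) (δ : ℝ) (hδ : δ ∈ Set.Ioo (0:ℝ) 1) :
    ENNReal.ofReal (1 - δ) ≤
      (Measure.pi fun _ : Fin n => 𝒟)
        {D | ∀ fhat ∈ F, (∀ g ∈ F, empLogLoss K n D fhat ≤ empLogLoss K n D g) →
          ∀ pihat : X → Fin K, Measurable pihat →
            (∀ x a, fhat x (pihat x) ≤ fhat x a) →
            (∫ x, fstar x (pihat x) ∂(𝒟.map Prod.fst))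
                - (∫ x, fstar x (πstar x) ∂(𝒟.map Prod.fst))
              ≤ 16 * Real.sqrt ((∫ x, fstar x (πstar x) ∂(𝒟.map Prod.fst))
                    * (K * (Real.log F.card + Real.log (K / δ)) / n))
                + 68 * (K * (Real.log F.card + Real.log (K / δ)) / n)} := by
  obtain ⟨hδ0, hδ1⟩ := hδ
  have hK0 : (1 : ℝ) ≤ K := by exact_mod_cast hK
  have hn0 : (0 : ℝ) < n := by exact_mod_cast hn
  have hN0 : (1 : ℝ) ≤ F.card := by exact_mod_cast hFne.card_pos
  have hcm : IsCondMean 𝒟 fstar := ⟨hℓ, hFm _ hfstar, hF01 _ hfstar, hreal⟩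
  have : IsProbabilityMeasure (𝒟.map Prod.fst) :=
    Measure.isProbabilityMeasure_map measurable_fst.aemeasurable
  set P := Measure.pi fun _ : Fin n => 𝒟
  set c : (X → Fin K → ℝ) → ℝ := fun f =>
    ∫ q, ∑ a, (K : ℝ)⁻¹ * binAffinity (fstar q.1 a) (f q.1 a) ∂𝒟
  have hc0 : ∀ f, 0 ≤ c f := fun f => integral_nonneg fun q => Finset.sum_nonneg fun a _ =>
    mul_nonneg (by positivity) (binAffinity_nonneg _ _)
  have hcmap : ∀ f ∈ F, c f
      = ∫ x, ∑ a, (K : ℝ)⁻¹ * binAffinity (fstar x a) (f x a) ∂(𝒟.map Prod.fst) := by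
    intro f hf
    rw [integral_map measurable_fst.aemeasurable]
    exact (Finset.measurable_sum _ fun a _ => (measurable_binAffinity (hFm _ hfstar a)
      (hFm _ hf a)).const_mul _).aestronglyMeasurable
  -- Models with small affinity to `fstar` are excluded by Markov's inequality and a union bound.
  set bad := F.filter fun f => c f ^ n ≤ δ / F.card
  set E : Set (Fin n → X × (Fin K → ℝ)) := ⋃ f ∈ bad, {D | 1 ≤ ∏ i, rootRatio fstar f (D i)}
  have hPE : P E ≤ ENNReal.ofReal δ := by
    calc P E ≤ ∑ f ∈ bad, P {D | 1 ≤ ∏ i, rootRatio fstar f (D i)} :=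
          measure_biUnion_finset_le _ _
      _ ≤ ∑ _f ∈ bad, ENNReal.ofReal (δ / F.card) := by
          refine Finset.sum_le_sum fun f hf => ?_
          obtain ⟨hfF, hfc⟩ := Finset.mem_filter.1 hf
          exact (hcm.measure_one_le_prod_rootRatio_le hK (hFm f hfF) (hF01 f hfF) n).trans
            (ENNReal.ofReal_le_ofReal hfc)
      _ ≤ ∑ _f ∈ F, ENNReal.ofReal (δ / F.card) :=
          Finset.sum_le_sum_of_subset (Finset.filter_subset _ _)
      _ = ENNReal.ofReal δ := by
          rw [Finset.sum_const, nsmul_eq_mul, ← ENNReal.ofReal_natCast,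
            ← ENNReal.ofReal_mul (by positivity)]
          congr 1
          field_simp
  have hgood : ∀ᵐ D ∂P, ∀ i : Fin n,
      (∀ a, (D i).2 a ∈ Set.Icc (0 : ℝ) 1) ∧
        ∀ a, LabelSupported ((D i).2 a) (fstar (D i).1 a) :=
    ae_all_iff.2 fun i =>
      (Measure.quasiMeasurePreserving_eval (fun _ : Fin n => 𝒟) i).ae
        (hℓ.and hcm.ae_labelSupported)
  set S : Set (Fin n → X × (Fin K → ℝ)) := {D | _}
  suffices hsub : ∀ᵐ D ∂P, D ∉ S → D ∈ E by
    have hSc : P Sᶜ ≤ ENNReal.ofReal δ := (measure_mono_ae hsub).trans hPE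
    have h1 : (1 : ℝ≥0∞) ≤ P S + P Sᶜ := by
      rw [← measure_univ (μ := P), ← Set.union_compl_self S]
      exact measure_union_le _ _
    rw [ENNReal.ofReal_sub _ hδ0.le, ENNReal.ofReal_one, tsub_le_iff_right]
    exact h1.trans (by gcongr)
  filter_upwards [hgood] with D hD
  contrapose!
  intro hDE fhat hfF hmin pihat hpim hpi
  have hprod := one_le_prod_rootRatio hK (fun i => (hD i).1) (fun i => hF01 fhat hfF _)
    (fun i => hF01 fstar hfstar _) (fun i => (hD i).2) (hmin fstar hfstar)
  have hcn : δ / F.card < c fhat ^ n := by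
    by_contra hcon
    exact hDE (Set.mem_biUnion (Finset.mem_filter.2 ⟨hfF, not_lt.1 hcon⟩) hprod)
  have hlog := one_sub_le_log_div hn (by positivity) (hc0 fhat) hcn
  have hlogle : Real.log (1 / (δ / F.card)) ≤ Real.log F.card + Real.log (K / δ) := by
    rw [← Real.log_mul (by positivity) (by positivity)]
    refine Real.log_le_log (by positivity) ?_
    rw [one_div_div, mul_div_assoc']
    gcongr
    nlinarith
  have hBpos : 0 < Real.log F.card + Real.log (K / δ) :=
    add_pos_of_nonneg_of_pos (Real.log_nonneg hN0)
      (Real.log_pos (by rw [lt_div_iff₀ hδ0]; linarith))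
  have hdef : 2 * K * (1 - c fhat)
      ≤ 2 * (K * (Real.log F.card + Real.log (K / δ)) / n) := by
    calc 2 * K * (1 - c fhat)
        ≤ 2 * K * ((Real.log F.card + Real.log (K / δ)) / n) := by
          gcongr
          exact hlog.trans (by gcongr)
      _ = _ := by ring
  refine le_sqrt_mul_add_of_forall_le (integral_nonneg fun x => (hF01 _ hfstar _ _).1)
    (by positivity) fun t ht => ?_
  have hreg := greedy_regret_le (ν := 𝒟.map Prod.fst) hK (hFm fhat hfF) (hFm fstar hfstar)
    (hF01 fhat hfF) (hF01 fstar hfstar) hpim hπsm (fun x => hpi x (πstar x)) ht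
  rw [← hcmap fhat hfF] at hreg
  have hmul := mul_le_mul_of_nonneg_left hdef (by positivity : 0 ≤ 2 / t + 1)
  refine hreg.trans ((add_le_add_right hmul _).trans (le_of_eq ?_))
  ring
end

section
/- Let A ≥ 1 and T ≥ 1 be integers and let γ ≥ 10A. For each t ∈ {1,…,T}, let ŷ_t ∈ (0,1)^A and f★_t ∈ [0,1]^A, let b_t ∈ argmin_a ŷ_{t,a}, and define p_{t,a} = ŷ_{t,b_t} / (A·ŷ_{t,b_t} + γ·(ŷ_{t,a} − ŷ_{t,b_t})) for a ≠ b_t and p_{t,b_t} = 1 − Σ_{a ≠ b_t} p_{t,a}; let a★_t ∈ argmin_a f★_{t,a}. Set L̄_T := Σ_{t=1}^T Σ_a p_{t,a}·f★_{t,a} and L̄★_T := Σ_{t=1}^T f★_{t,a★_t}. Then L̄_T − L̄★_T ≤ (10A/γ)·L̄★_T + 28·γ·Σ_{t=1}^T Σ_a p_{t,a}·d_KL(f★_{t,a} ‖ ŷ_{t,a}). -/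
/-- The binary Kullback–Leibler divergence
`d_KL(p ‖ q) = p·log(p/q) + (1−p)·log((1−p)/(1−q))` (with `0·log 0 = 0`). -/
noncomputable def dKL (p q : ℝ) : ℝ :=
  p * Real.log (p / q) + (1 - p) * Real.log ((1 - p) / (1 - q))

lemma two_mul_sub_sqrt_mul_le_mul_log_div {p q : ℝ} (hp : 0 ≤ p) (hq : 0 < q) :
    2 * (p - √p * √q) ≤ p * Real.log (p / q) := by
  rcases hp.eq_or_lt with rfl | hp
  · simp
  have hsp : 0 < √p := Real.sqrt_pos.2 hp
  have hsq : 0 < √q := Real.sqrt_pos.2 hq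
  have h := Real.log_le_sub_one_of_pos (div_pos hsq hsp)
  have hlog : Real.log (p / q) = -(2 * Real.log (√q / √p)) := by
    rw [Real.log_div hp.ne' hq.ne', Real.log_div hsq.ne' hsp.ne', Real.log_sqrt hp.le,
      Real.log_sqrt hq.le]
    ring
  have hmul : p * (√q / √p) = √p * √q := by
    nth_rewrite 1 [← Real.mul_self_sqrt hp.le]
    field_simp
  rw [hlog]
  nlinarith [mul_le_mul_of_nonneg_left h hp.le]

/-- The binary KL divergence dominates the squared Hellinger distance of the first coordinates. -/
lemma sq_sqrt_sub_sqrt_le_dKL {f y : ℝ} (hf : f ∈ Set.Icc (0 : ℝ) 1) (hy : y ∈ Set.Ioo (0 : ℝ) 1) :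
    (√f - √y) ^ 2 ≤ dKL f y := by
  have h₁ := two_mul_sub_sqrt_mul_le_mul_log_div hf.1 hy.1
  have h₂ := two_mul_sub_sqrt_mul_le_mul_log_div (sub_nonneg.2 hf.2) (sub_pos.2 hy.2)
  have e₁ := Real.sq_sqrt hf.1
  have e₂ := Real.sq_sqrt hy.1.le
  have e₃ := Real.sq_sqrt (sub_nonneg.2 hf.2)
  have e₄ := Real.sq_sqrt (sub_pos.2 hy.2).le
  unfold dKL
  nlinarith [sq_nonneg (√(1 - f) - √(1 - y))]

lemma sub_le_mul_add_div_of_sq_sqrt_sub_sqrt_le {f y d ε : ℝ} (hf : 0 ≤ f) (hy : 0 ≤ y)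
    (hd : (√f - √y) ^ 2 ≤ d) (hε : 0 < ε) : f - y ≤ ε * f + d / ε := by
  have e₁ := Real.sq_sqrt hf
  have e₂ := Real.sq_sqrt hy
  have hdiv : (√f - √y) ^ 2 / ε ≤ d / ε := by gcongr
  have hsq : 0 ≤ (ε * √f - (√f - √y)) ^ 2 / ε := by positivity
  have hexp : (ε * √f - (√f - √y)) ^ 2 / ε
      = ε * √f ^ 2 - 2 * √f * (√f - √y) + (√f - √y) ^ 2 / ε := by
    field_simp
    ring
  nlinarith [sq_nonneg (√f - √y)]

lemma le_two_mul_add_of_sq_sqrt_sub_sqrt_le {f y d : ℝ} (hf : 0 ≤ f) (hy : 0 ≤ y)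
    (hd : (√f - √y) ^ 2 ≤ d) : y ≤ 2 * f + 2 * d := by
  have e₁ := Real.sq_sqrt hf
  have e₂ := Real.sq_sqrt hy
  nlinarith [sq_nonneg (2 * √f - √y)]

lemma le_twelve_mul_of_sq_sqrt_sub_sqrt_le {f y d : ℝ} (hf : 0 ≤ f) (hfy : 2 * f ≤ y)
    (hd : (√f - √y) ^ 2 ≤ d) : y ≤ 12 * d := by
  have e₁ := Real.sq_sqrt hf
  have e₂ := Real.sq_sqrt (by linarith : 0 ≤ y)
  have hu := Real.sqrt_nonneg f
  have hv := Real.sqrt_nonneg y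
  have h : 24 * √f ≤ 17 * √y := abs_le_of_sq_le_sq' (by nlinarith) (by positivity) |>.2
  nlinarith

section InverseGapWeighting

variable {A γ β y f d : ℝ}

lemma sub_le_of_inverse_gap_weight (hA : 1 ≤ A) (hγ : A ≤ γ) (hβ : 0 < β) (hy : β ≤ y)
    (hf : 0 ≤ f) (hd : (√f - √y) ^ 2 ≤ d) :
    β - f ≤ A / γ * β + 12 * γ * (β / (A * β + γ * (y - β)) * d) := by
  have hγ0 : 0 < γ := by linarith
  have hd0 : 0 ≤ d := (sq_nonneg _).trans hd
  have hgap : 0 ≤ γ * (y - β) := mul_nonneg hγ0.le (by linarith)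
  have hD : 0 < A * β + γ * (y - β) := by positivity
  set p := β / (A * β + γ * (y - β)) with hp
  have hp0 : 0 < p := by positivity
  have hpD : p * (A * β + γ * (y - β)) = β := by rw [hp]; field_simp
  have hx0 : 0 < A / γ := by positivity
  rcases le_or_gt y (2 * β) with h | h
  · have hε : 0 < 1 / (2 * γ * p) := by positivity
    have key := sub_le_mul_add_div_of_sq_sqrt_sub_sqrt_le (d := d) (hβ.le.trans hy) hf
      (by rwa [← neg_sub, neg_sq]) hε
    have hval : 1 / (2 * γ * p) = (A / γ + (y - β) / β) / 2 := by
      rw [hp]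
      field_simp
    have hdiv : d / (1 / (2 * γ * p)) = 2 * γ * (p * d) := by field_simp
    have hmul : 1 / (2 * γ * p) * y ≤ 1 / (2 * γ * p) * (2 * β) := by gcongr
    have hval' : 1 / (2 * γ * p) * (2 * β) = A / γ * β + (y - β) := by
      rw [hval]
      field_simp
    have : 0 ≤ γ * (p * d) := by positivity
    rw [hdiv] at key
    linarith
  · rcases le_or_gt β f with hβf | hβf
    · have : 0 ≤ A / γ * β + 12 * γ * (p * d) := by positivity
      linarith
    · have hyd := le_twelve_mul_of_sq_sqrt_sub_sqrt_le hf (by linarith) hd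
      have hpy : β ≤ γ * (p * y) := by nlinarith [mul_nonneg hp0.le hβ.le]
      have : γ * (p * y) ≤ γ * (p * (12 * d)) := by gcongr
      have : 0 ≤ A / γ * β := by positivity
      linarith

lemma sub_le_of_inv_le_weight {p : ℝ} (hA : 1 ≤ A) (hγ : A ≤ γ) (hβ : 0 < β)
    (hf : 0 ≤ f) (hd : (√f - √β) ^ 2 ≤ d) (hp : 1 / A ≤ p) :
    β - f ≤ A / γ * β + 12 * γ * (p * d) := by
  have hγ0 : 0 < γ := by linarith
  have hd0 : 0 ≤ d := (sq_nonneg _).trans hd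
  have key := sub_le_mul_add_div_of_sq_sqrt_sub_sqrt_le (d := d) hβ.le hf
    (by rwa [← neg_sub, neg_sq]) (by positivity : 0 < A / γ)
  have hdiv : d / (A / γ) = γ * (1 / A * d) := by field_simp
  have : γ * (1 / A * d) ≤ γ * (p * d) := by gcongr
  have : 0 ≤ γ * (1 / A * d) := by positivity
  linarith

lemma inverse_gap_weight_mul_gap_le (hA : 1 ≤ A) (hγ : A ≤ γ) (hβ : 0 < β) (hy : β ≤ y) :
    β / (A * β + γ * (y - β)) * (y - β) ≤ β / γ := by
  have hγ0 : 0 < γ := by linarith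
  have hgap : 0 ≤ γ * (y - β) := mul_nonneg hγ0.le (by linarith)
  have hD : 0 < A * β + γ * (y - β) := by positivity
  rw [div_mul_eq_mul_div, div_le_div_iff₀ hD hγ0]
  nlinarith [mul_pos (by linarith : 0 < A) (mul_pos hβ hβ)]

end InverseGapWeighting

/-- The one-round regret bound for inverse gap weighting. -/
lemma inverse_gap_weighting_round (A : ℕ) (hA : 1 ≤ A) (γ : ℝ) (hγ : 10 * A ≤ γ)
    (y f p : Fin A → ℝ) (hy : ∀ a, y a ∈ Set.Ioo (0 : ℝ) 1) (hf : ∀ a, f a ∈ Set.Icc (0 : ℝ) 1)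
    (b : Fin A) (hb : ∀ a, y b ≤ y a)
    (hp : ∀ a, a ≠ b → p a = y b / (A * y b + γ * (y a - y b)))
    (hpb : p b = 1 - ∑ a ∈ Finset.univ.erase b, p a) (s : Fin A) :
    ∑ a, p a * f a - f s ≤ 10 * A / γ * f s + 28 * γ * ∑ a, p a * dKL (f a) (y a) := by
  have hA' : (1 : ℝ) ≤ A := by exact_mod_cast hA
  have hγ0 : 0 < γ := by linarith
  have hAγ : (A : ℝ) ≤ γ := by linarith
  have hβ : 0 < y b := (hy b).1
  have hH a := sq_sqrt_sub_sqrt_le_dKL (hf a) (hy a)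
  have hd a : 0 ≤ dKL (f a) (y a) := (sq_nonneg _).trans (hH a)
  have hsum : ∑ a, p a = 1 := by
    rw [← Finset.add_sum_erase _ _ (Finset.mem_univ b), hpb]
    ring
  have hpne a (ha : a ≠ b) : 0 ≤ p a ∧ p a ≤ 1 / A := by
    have hgap : 0 ≤ γ * (y a - y b) := mul_nonneg hγ0.le (by linarith [hb a])
    have hD : 0 < A * y b + γ * (y a - y b) := by positivity
    rw [hp a ha]
    refine ⟨by positivity, ?_⟩
    rw [div_le_div_iff₀ hD (by linarith)]
    linarith
  have hpb' : 1 / (A : ℝ) ≤ p b := by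
    have h := Finset.sum_le_card_nsmul (Finset.univ.erase b) p (1 / (A : ℝ))
      fun a ha => (hpne a (Finset.ne_of_mem_erase ha)).2
    rw [Finset.card_erase_of_mem (Finset.mem_univ b), Finset.card_univ, Fintype.card_fin,
      nsmul_eq_mul, Nat.cast_sub hA, Nat.cast_one, sub_mul, mul_one_div_cancel (by linarith)] at h
    linarith
  have hp0 a : 0 ≤ p a := by
    rcases eq_or_ne a b with rfl | ha
    · exact le_trans (by positivity) hpb'
    · exact (hpne a ha).1
  have hE0 a : 0 ≤ p a * dKL (f a) (y a) := mul_nonneg (hp0 a) (hd a)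
  set E := ∑ a, p a * dKL (f a) (y a) with hE
  set F := ∑ a, p a * f a with hF
  have hE_nonneg : 0 ≤ E := Finset.sum_nonneg fun a _ => hE0 a
  have hx : 0 < (A : ℝ) / γ := by positivity
  have hx10 : (A : ℝ) / γ ≤ 1 / 10 := by
    rw [div_le_div_iff₀ hγ0 (by norm_num)]
    linarith
  have hs : y b - f s ≤ A / γ * y b + 12 * γ * E := by
    have hsE : p s * dKL (f s) (y s) ≤ E :=
      Finset.single_le_sum (f := fun a => p a * dKL (f a) (y a)) (fun a _ => hE0 a)
        (Finset.mem_univ s)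
    have h : y b - f s ≤ A / γ * y b + 12 * γ * (p s * dKL (f s) (y s)) := by
      rcases eq_or_ne s b with rfl | hsb
      · exact sub_le_of_inv_le_weight hA' hAγ hβ (hf s).1 (hH s) hpb'
      · rw [hp s hsb]
        exact sub_le_of_inverse_gap_weight hA' hAγ hβ (hb s) (hf s).1 (hH s)
    have : 12 * γ * (p s * dKL (f s) (y s)) ≤ 12 * γ * E := by gcongr
    linarith
  have hgap : ∑ a, p a * (y a - y b) ≤ A / γ * y b := by
    have h : ∑ a, p a * (y a - y b) ≤ ∑ _a : Fin A, y b / γ := by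
      refine Finset.sum_le_sum fun a _ => ?_
      rcases eq_or_ne a b with rfl | ha
      · simpa using div_nonneg hβ.le hγ0.le
      · rw [hp a ha]
        exact inverse_gap_weight_mul_gap_le hA' hAγ hβ (hb a)
    rw [Finset.sum_const, Finset.card_univ, Fintype.card_fin, nsmul_eq_mul] at h
    rwa [div_mul_eq_mul_div, ← mul_div_assoc']
  have hest : ∑ a, p a * (f a - y a) ≤ A / γ * F + γ * E := by
    rw [hE, hF, Finset.mul_sum, Finset.mul_sum, ← Finset.sum_add_distrib]
    refine Finset.sum_le_sum fun a _ => ?_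
    have h := sub_le_mul_add_div_of_sq_sqrt_sub_sqrt_le (hf a).1 (hy a).1.le (hH a) hx
    have hdiv : dKL (f a) (y a) / (A / γ) ≤ γ * dKL (f a) (y a) := by
      rw [div_div_eq_mul_div, mul_comm]
      exact div_le_self (mul_nonneg hγ0.le (hd a)) hA'
    nlinarith [mul_le_mul_of_nonneg_left (h.trans (add_le_add_right hdiv _)) (hp0 a)]
  have hβF : y b ≤ 2 * F + 2 * E := by
    calc y b = ∑ a, p a * y b := by rw [← Finset.sum_mul, hsum, one_mul]
      _ ≤ ∑ a, (2 * (p a * f a) + 2 * (p a * dKL (f a) (y a))) := by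
        refine Finset.sum_le_sum fun a _ => ?_
        have h := (hb a).trans
          (le_two_mul_add_of_sq_sqrt_sub_sqrt_le (hf a).1 (hy a).1.le (hH a))
        nlinarith [mul_le_mul_of_nonneg_left h (hp0 a)]
      _ = 2 * F + 2 * E := by rw [Finset.sum_add_distrib, ← Finset.mul_sum, ← Finset.mul_sum]
  have hdecomp : F = ∑ a, p a * (f a - y a) + ∑ a, p a * (y a - y b) + y b := by
    have : y b = ∑ a, p a * y b := by rw [← Finset.sum_mul, hsum, one_mul]
    rw [hF]
    nth_rewrite 2 [this]
    rw [← Finset.sum_add_distrib, ← Finset.sum_add_distrib]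
    exact Finset.sum_congr rfl fun a _ => by ring
  rw [mul_div_assoc]
  set x := (A : ℝ) / γ
  have hG : 0 ≤ γ * E := by positivity
  have hEG : 10 * E ≤ γ * E := by nlinarith
  have hxE : 4 * (x * E) ≤ γ * E := by nlinarith
  have hmain : (1 - 5 * x) * F ≤ f s + 14 * (γ * E) := by
    nlinarith [mul_le_mul_of_nonneg_left hβF hx.le]
  have hfs := (hf s).1
  have hrhs : f s + 14 * (γ * E) ≤ (1 - 5 * x) * ((1 + 10 * x) * f s + 28 * (γ * E)) := by
    have h₁ : 0 ≤ x * (1 - 10 * x) * f s :=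
      mul_nonneg (mul_nonneg hx.le (by linarith)) hfs
    have h₂ : 0 ≤ (1 - 10 * x) * (γ * E) := mul_nonneg (by linarith) hG
    nlinarith
  have := le_of_mul_le_mul_left (hmain.trans hrhs) (by linarith)
  linarith

/-- The deterministic core of Theorem `thm:main`: summing the per-round
inequality over rounds and passing to the binary KL divergence yields
`L̄_T − L̄★_T ≤ (10A/γ)·L̄★_T + 28γ·Σ_t Σ_a p_{t,a}·d_KL(f★_{t,a} ‖ ŷ_{t,a})`. -/
theorem stmt_15 (A T : ℕ) (hA : 1 ≤ A) (hT : 1 ≤ T)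
    (γ : ℝ) (hγ : 10 * A ≤ γ)
    (yhat : Fin T → Fin A → ℝ) (hyhat : ∀ t a, yhat t a ∈ Set.Ioo (0:ℝ) 1)
    (fstar : Fin T → Fin A → ℝ) (hfstar : ∀ t a, fstar t a ∈ Set.Icc (0:ℝ) 1)
    (b : Fin T → Fin A) (hb : ∀ t a, yhat t (b t) ≤ yhat t a)
    (p : Fin T → Fin A → ℝ)
    (hp : ∀ t a, a ≠ b t →
      p t a = yhat t (b t) / (A * yhat t (b t) + γ * (yhat t a - yhat t (b t))))
    (hpb : ∀ t, p t (b t) = 1 - ∑ a ∈ Finset.univ.erase (b t), p t a)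
    (astar : Fin T → Fin A) (hastar : ∀ t a, fstar t (astar t) ≤ fstar t a) :
    (∑ t, ∑ a, p t a * fstar t a) - (∑ t, fstar t (astar t))
      ≤ (10 * A / γ) * (∑ t, fstar t (astar t))
        + 28 * γ * ∑ t, ∑ a, p t a * dKL (fstar t a) (yhat t a) := by
  rw [← Finset.sum_sub_distrib, Finset.mul_sum, Finset.mul_sum, ← Finset.sum_add_distrib]
  exact Finset.sum_le_sum fun t _ => inverse_gap_weighting_round A hA γ hγ (yhat t) (fstar t) (p t)
    (hyhat t) (hfstar t) (b t) (hb t) (hp t) (hpb t) (astar t)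
end

section
/- For every integer n > 10^8 there exist: a two-element context set X = {x⁽¹⁾, x⁽²⁾}, a two-element action set A = {a⁽¹⁾, a⁽²⁾}, a function class F ⊆ (X × A → [0,1]) with |F| = 2, and a probability distribution 𝒟 over pairs (x, ℓ) with ℓ ∈ [0,1]^A, such that: (i) there is f★ ∈ F with f★(x,a) = E_𝒟[ℓ(a) | x] for all (x,a); (ii) L★ := min_{π : X → A} E_𝒟[f★(x, π(x))] ≤ 2^7/n < 1; and (iii) with probability at least 1/10 over n i.i.d. samples (x_1,ℓ_1),…,(x_n,ℓ_n) from 𝒟, every f̂ ∈ argmin_{f ∈ F} Σ_{i=1}^n Σ_a (f(x_i,a) − ℓ_i(a))² satisfies E_𝒟[f★(x, π_{f̂}(x))] − L★ ≥ 2^{−5}·n^{−1/2}, where π_{f̂}(x) ∈ argmin_a f̂(x,a). -/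
open MeasureTheory

section ThreeAtoms

variable {Ω : Type*} [MeasurableSpace Ω]

/-- The measure with mass `1 - 2 * r` at `u` and mass `r` at each of `v` and `w`. -/
noncomputable def threeAtoms (r : ℝ) (u v w : Ω) : Measure Ω :=
  ENNReal.ofReal (1 - 2 * r) • Measure.dirac u +
    (ENNReal.ofReal r • Measure.dirac v + ENNReal.ofReal r • Measure.dirac w)

variable {r : ℝ}

lemma isProbabilityMeasure_threeAtoms (hr : 0 ≤ r) (hr' : 2 * r ≤ 1) (u v w : Ω) :
    IsProbabilityMeasure (threeAtoms r u v w) := by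
  constructor
  simp only [threeAtoms, Measure.add_apply, Measure.smul_apply, measure_univ, smul_eq_mul, mul_one]
  rw [← ENNReal.ofReal_add hr hr, ← ENNReal.ofReal_add (by linarith) (by linarith)]
  ring_nf
  simp

variable [MeasurableSingletonClass Ω]

lemma ae_threeAtoms {u v w : Ω} {P : Ω → Prop} (hu : P u) (hv : P v) (hw : P w) :
    ∀ᵐ q ∂threeAtoms r u v w, P q := by
  simp only [threeAtoms, ae_add_measure_iff]
  refine ⟨Measure.ae_smul_measure ?_ _, Measure.ae_smul_measure ?_ _,
    Measure.ae_smul_measure ?_ _⟩ <;> simpa [ae_dirac_eq]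

lemma integral_threeAtoms (hr : 0 ≤ r) (hr' : 2 * r ≤ 1) (u v w : Ω) (g : Ω → ℝ) :
    ∫ q, g q ∂threeAtoms r u v w = (1 - 2 * r) * g u + r * g v + r * g w := by
  have hint (c : ℝ) (y : Ω) : Integrable g (ENNReal.ofReal c • Measure.dirac y) :=
    (integrable_dirac enorm_lt_top).smul_measure ENNReal.ofReal_ne_top
  rw [threeAtoms, integral_add_measure (hint _ _) ((hint _ _).add_measure (hint _ _)),
    integral_add_measure (hint _ _) (hint _ _)]
  simp only [integral_smul_measure, integral_dirac, smul_eq_mul, ENNReal.toReal_ofReal hr,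
    ENNReal.toReal_ofReal (sub_nonneg.2 hr')]
  ring

lemma threeAtoms_singleton {u v w : Ω} (huv : u ≠ v) (huw : u ≠ w) :
    threeAtoms r u v w {u} = ENNReal.ofReal (1 - 2 * r) := by
  simp [threeAtoms, huv.symm, huw.symm]

lemma threeAtoms_pair (hr : 0 ≤ r) (hr' : 2 * r ≤ 1) {u v w : Ω} (huw : u ≠ w) (hvw : v ≠ w) :
    threeAtoms r u v w {u, v} = ENNReal.ofReal (1 - r) := by
  simp only [threeAtoms, Measure.add_apply, Measure.smul_apply, smul_eq_mul]
  rw [Measure.dirac_apply, Measure.dirac_apply, Measure.dirac_apply]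
  simp only [Set.mem_insert_iff, Set.mem_singleton_iff, true_or, or_true, huw.symm, hvw.symm,
    or_self, not_false_eq_true, Set.indicator_of_mem, Set.indicator_of_notMem, Pi.one_apply,
    mul_one, mul_zero, add_zero]
  rw [← ENNReal.ofReal_add (by linarith) hr]
  ring_nf

/-- Among `n` samples, the third atom is absent and the second one present with probability
at least `(1 - r) ^ n - (1 - 2 * r) ^ n`. -/
lemma pi_threeAtoms_ge (n : ℕ) (hr : 0 ≤ r) (hr' : 2 * r ≤ 1) {u v w : Ω}
    (huv : u ≠ v) (huw : u ≠ w) (hvw : v ≠ w) :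
    ENNReal.ofReal ((1 - r) ^ n - (1 - 2 * r) ^ n) ≤
      (Measure.pi fun _ : Fin n => threeAtoms r u v w)
        {D | (∀ i, D i = u ∨ D i = v) ∧ ∃ i, D i = v} := by
  have := isProbabilityMeasure_threeAtoms hr hr' u v w
  set μ := Measure.pi fun _ : Fin n => threeAtoms r u v w
  have hpair : μ (Set.univ.pi fun _ => {u, v}) = ENNReal.ofReal ((1 - r) ^ n) := by
    rw [Measure.pi_pi]
    simp [threeAtoms_pair hr hr' huw hvw, ENNReal.ofReal_pow (show (0 : ℝ) ≤ 1 - r by linarith)]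
  have hsingle : μ (Set.univ.pi fun _ => {u}) = ENNReal.ofReal ((1 - 2 * r) ^ n) := by
    rw [Measure.pi_pi]
    simp [threeAtoms_singleton huv huw, ENNReal.ofReal_pow (sub_nonneg.2 hr')]
  rw [ENNReal.ofReal_sub _ (pow_nonneg (sub_nonneg.2 hr') n), ← hpair, ← hsingle]
  refine le_measure_sdiff.trans (measure_mono ?_)
  rintro D ⟨hD, hDu⟩
  simp only [Set.mem_pi, Set.mem_univ, true_implies, Set.mem_insert_iff,
    Set.mem_singleton_iff] at hD hDu
  push Not at hDu
  obtain ⟨i, hi⟩ := hDu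
  exact ⟨hD, i, (hD i).resolve_left hi⟩

end ThreeAtoms

lemma tenth_le_pow_sub_pow {n : ℕ} (hn : 0 < n) :
    (1 / 10 : ℝ) ≤ (1 - 1 / (2 * n)) ^ n - (1 - 2 * (1 / (2 * n))) ^ n := by
  have hn' : (1 : ℝ) ≤ n := by exact_mod_cast hn
  have hinv : (1 / (2 * n) : ℝ) ≤ 1 / 2 := by
    rw [div_le_div_iff₀ (by positivity) (by norm_num)]; linarith
  have lower : (1 / 2 : ℝ) ≤ (1 - 1 / (2 * n)) ^ n := by
    have h := one_add_mul_le_pow (a := -(1 / (2 * n) : ℝ)) (by linarith) n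
    rw [← sub_eq_add_neg] at h
    refine le_trans (le_of_eq ?_) h
    field_simp
    norm_num
  have upper : (1 - 2 * (1 / (2 * n)) : ℝ) ^ n ≤ Real.exp (-1) := by
    have h := Real.one_sub_div_pow_le_exp_neg (n := n) (t := 1) hn'
    rwa [show (1 - 2 * (1 / (2 * n)) : ℝ) = 1 - 1 / n by field_simp]
  have := Real.exp_neg_one_lt_d9
  linarith

/-- The regression function: losses `0` and `d` in the common context, and `1 / 2` for both
actions in the rare one. -/
noncomputable def trueRegressor (d : ℝ) : Fin 2 → Fin 2 → ℝ := ![![0, d], ![1 / 2, 1 / 2]]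

/-- The competitor, which swaps the actions in the common context and predicts `1` in the
rare one. -/
def swappedRegressor (d : ℝ) : Fin 2 → Fin 2 → ℝ := ![![d, 0], ![1, 1]]

/-- The loss distribution: a noiseless common context, and a rare one of probability `2 * r`
whose losses are both `1` or both `0`. -/
noncomputable def plugInDist (r d : ℝ) : Measure (Fin 2 × (Fin 2 → ℝ)) :=
  threeAtoms r (0, ![0, d]) (1, ![1, 1]) (1, ![0, 0])

lemma trueRegressor_ne_swappedRegressor (d : ℝ) : trueRegressor d ≠ swappedRegressor d := by
  intro h
  have := congrFun (congrFun h 1) 0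
  norm_num [trueRegressor, swappedRegressor] at this

lemma integral_map_fst_plugInDist {r : ℝ} (hr : 0 ≤ r) (hr' : 2 * r ≤ 1) (d : ℝ)
    (g : Fin 2 → ℝ) :
    ∫ x, g x ∂((plugInDist r d).map Prod.fst) = (1 - 2 * r) * g 0 + 2 * r * g 1 := by
  rw [integral_map measurable_fst.aemeasurable
    (measurable_of_finite g).aestronglyMeasurable, plugInDist, integral_threeAtoms hr hr']
  ring

lemma setIntegral_plugInDist {r : ℝ} (hr : 0 ≤ r) (hr' : 2 * r ≤ 1) (d : ℝ) (x a : Fin 2) :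
    ∫ q in Prod.fst ⁻¹' {x}, q.2 a ∂(plugInDist r d) =
      trueRegressor d x a * (plugInDist r d (Prod.fst ⁻¹' {x})).toReal := by
  have hs : MeasurableSet (Prod.fst ⁻¹' {x} : Set (Fin 2 × (Fin 2 → ℝ))) :=
    measurable_fst (measurableSet_singleton x)
  have hreal : (plugInDist r d (Prod.fst ⁻¹' {x})).toReal =
      ∫ q, (Prod.fst ⁻¹' {x}).indicator 1 q ∂(plugInDist r d) :=
    (integral_indicator_one hs).symm
  rw [hreal, ← integral_indicator hs, plugInDist, integral_threeAtoms hr hr',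
    integral_threeAtoms hr hr']
  fin_cases x <;> fin_cases a <;> simp [trueRegressor, Set.indicator] <;> ring

/-- When the rare context is sampled, and always with losses `1`, the competitor has the
smaller empirical squared error. -/
lemma squaredError_swappedRegressor_lt {n : ℕ} {d : ℝ} (hd : 4 * (n * d ^ 2) < 1)
    {D : Fin n → Fin 2 × (Fin 2 → ℝ)}
    (hD : ∀ i, D i = (0, ![0, d]) ∨ D i = (1, ![1, 1])) (hv : ∃ i, D i = (1, ![1, 1])) :
    ∑ i, ∑ a, (swappedRegressor d (D i).1 a - (D i).2 a) ^ 2 <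
      ∑ i, ∑ a, (trueRegressor d (D i).1 a - (D i).2 a) ^ 2 := by
  obtain ⟨j, hj⟩ := hv
  have upper : ∑ i, ∑ a, (swappedRegressor d (D i).1 a - (D i).2 a) ^ 2 ≤ n * (2 * d ^ 2) := by
    have h := Finset.sum_le_card_nsmul Finset.univ
      (fun i => ∑ a, (swappedRegressor d (D i).1 a - (D i).2 a) ^ 2) (2 * d ^ 2) fun i _ => by
        rcases hD i with h | h <;> simp [h, swappedRegressor] <;> nlinarith [sq_nonneg d]
    simpa using h
  have lower : 1 / 2 ≤ ∑ i, ∑ a, (trueRegressor d (D i).1 a - (D i).2 a) ^ 2 := by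
    have h := Finset.single_le_sum
      (f := fun i => ∑ a, (trueRegressor d (D i).1 a - (D i).2 a) ^ 2)
      (fun i _ => Finset.sum_nonneg fun a _ => sq_nonneg _) (Finset.mem_univ j)
    refine le_trans (le_of_eq ?_) h
    norm_num [hj, trueRegressor]
  linarith

/-- Theorem `thm:least_squares_plugin` (failure of least-squares for
plug-in classification): for every `n > 10^8` there is a two-function realizable class
over two contexts and two actions with optimal loss `L★ ≤ 2^7/n < 1`, such that with
probability at least `1/10` over `n` i.i.d. samples, every empirical least-squares
minimizer induces a policy with excess loss at least `2^{−5}·n^{−1/2}`. Realizability is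
expressed via set integrals over the (finitely many) contexts, and the minimum `L★` over
policies is written as an infimum over `π : Fin 2 → Fin 2`. -/
theorem stmt_16 (n : ℕ) (hn : 10 ^ 8 < n) :
    ∃ (F : Finset (Fin 2 → Fin 2 → ℝ)) (𝒟 : Measure (Fin 2 × (Fin 2 → ℝ))),
      ∃ _ : IsProbabilityMeasure 𝒟,
      F.card = 2 ∧
      (∀ f ∈ F, ∀ x a, f x a ∈ Set.Icc (0:ℝ) 1) ∧
      (∀ᵐ q ∂𝒟, ∀ a, q.2 a ∈ Set.Icc (0:ℝ) 1) ∧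
      ∃ fstar ∈ F,
        (∀ (x : Fin 2) (a : Fin 2),
          ∫ q in Prod.fst ⁻¹' {x}, q.2 a ∂𝒟
            = fstar x a * (𝒟 (Prod.fst ⁻¹' {x})).toReal) ∧
        (⨅ π : Fin 2 → Fin 2, ∫ x, fstar x (π x) ∂(𝒟.map Prod.fst)) ≤ 2 ^ 7 / n ∧
        (2:ℝ) ^ 7 / n < 1 ∧
        ENNReal.ofReal (1 / 10) ≤
          (Measure.pi fun _ : Fin n => 𝒟)
            {D | ∀ fhat ∈ F,
              (∀ g ∈ F, (∑ i, ∑ a, (fhat (D i).1 a - (D i).2 a) ^ 2)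
                  ≤ ∑ i, ∑ a, (g (D i).1 a - (D i).2 a) ^ 2) →
              ∀ pif : Fin 2 → Fin 2, (∀ x a, fhat x (pif x) ≤ fhat x a) →
                (2:ℝ) ^ (-5 : ℤ) / Real.sqrt n ≤
                  (∫ x, fstar x (pif x) ∂(𝒟.map Prod.fst))
                    - ⨅ π : Fin 2 → Fin 2, ∫ x, fstar x (π x) ∂(𝒟.map Prod.fst)} := by
  have hn' : (10 : ℝ) ^ 8 < n := by exact_mod_cast hn
  have hn0 : (0 : ℝ) < n := by linarith
  have hsqrt : 1 ≤ Real.sqrt n := Real.one_le_sqrt.2 (by linarith)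
  set r : ℝ := 1 / (2 * n) with hr_def
  set d : ℝ := 1 / (16 * Real.sqrt n) with hd_def
  have hr : 0 ≤ r := by positivity
  have hr' : 2 * r ≤ 1 / 2 := by
    rw [show 2 * r = 1 / n by rw [hr_def]; field_simp,
      div_le_div_iff₀ hn0 (by norm_num)]
    linarith
  have hr1 : 2 * r ≤ 1 := by linarith
  have hd : 0 < d := by positivity
  have hd1 : d ≤ 1 := by
    rw [hd_def, div_le_one (by positivity)]; linarith
  have hnd : 4 * (n * d ^ 2) < 1 := by
    rw [hd_def, div_pow, mul_pow, Real.sq_sqrt hn0.le]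
    field_simp
    norm_num
  have hinf : (⨅ π : Fin 2 → Fin 2,
      ∫ x, trueRegressor d x (π x) ∂((plugInDist r d).map Prod.fst)) ≤ r := by
    refine (ciInf_le (Set.finite_range _).bddBelow 0).trans (le_of_eq ?_)
    rw [integral_map_fst_plugInDist hr hr1]
    simp [trueRegressor]
    ring
  refine ⟨{trueRegressor d, swappedRegressor d}, plugInDist r d,
    isProbabilityMeasure_threeAtoms hr hr1 _ _ _,
    Finset.card_pair (trueRegressor_ne_swappedRegressor d), ?_, ?_, trueRegressor d, by simp,
    setIntegral_plugInDist hr hr1 d, ?_, ?_, ?_⟩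
  · intro f hf x a
    rw [Finset.mem_insert, Finset.mem_singleton] at hf
    rcases hf with rfl | rfl <;> fin_cases x <;> fin_cases a <;>
      norm_num [trueRegressor, swappedRegressor, hd.le, hd1]
  · apply ae_threeAtoms <;> intro a <;> fin_cases a <;> simp [hd.le, hd1]
  · refine hinf.trans ?_
    rw [hr_def, div_le_div_iff₀ (by positivity) hn0]
    linarith
  · rw [div_lt_one hn0]
    linarith
  · refine (ENNReal.ofReal_le_ofReal (tenth_le_pow_sub_pow (by lia))).trans
      ((pi_threeAtoms_ge n hr hr1 (by simp) (by simp) (by simp)).trans (measure_mono ?_))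
    rintro D ⟨hD, hv⟩ f hf hmin π hπ
    have hlt := squaredError_swappedRegressor_lt hnd hD hv
    rw [Finset.mem_insert, Finset.mem_singleton] at hf
    rcases hf with rfl | rfl
    · exact absurd (hmin (swappedRegressor d) (by simp)) hlt.not_ge
    have hπ0 : π 0 = 1 := by
      by_contra h
      have h0 : π 0 = 0 := by lia
      have := hπ 0 1
      rw [h0] at this
      simp [swappedRegressor] at this
      linarith
    have hvalue : trueRegressor d 0 (π 0) = d := by simp [hπ0, trueRegressor]
    have hrare (a : Fin 2) : trueRegressor d 1 a = 1 / 2 := by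
      fin_cases a <;> simp [trueRegressor]
    rw [integral_map_fst_plugInDist hr hr1, hvalue, hrare]
    have hhalf : (2 : ℝ) ^ (-5 : ℤ) / Real.sqrt n = 1 / 2 * d := by
      rw [hd_def]; field_simp; norm_num
    rw [hhalf]
    nlinarith
end

section
/- Let X be a measurable space equipped with a probability measure μ, let A = {1,…,K} be a finite action set, and let f, f★ : X × A → [0,1] be measurable. Let π_f, π★ : X → A be measurable maps such that for every x, π_f(x) ∈ argmin_a f(x,a) and π★(x) ∈ argmin_a f★(x,a). Define L(π) := ∫ f★(x, π(x)) dμ(x), L★ := L(π★), and Δ := ∫ D_Δ(f★(x,·) ‖ f(x,·)) dμ(x). Then L(π_f) ≤ 12·√2·Δ + 3·L★. -/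
open MeasureTheory

/-- Each term of the triangular discrimination dominates its tangent lines. -/
lemma two_mul_sub_le_sq_div_add {a b : ℝ} (ha : 0 ≤ a) (hb : 0 ≤ b) (t : ℝ) :
    2 * t * (a - b) - t ^ 2 * (a + b) ≤ (a - b) ^ 2 / (a + b) := by
  rcases (add_nonneg ha hb).eq_or_lt with h | h
  · have ha0 : a = 0 := by linarith
    have hb0 : b = 0 := by linarith
    simp [ha0, hb0]
  · rw [le_div_iff₀ h]
    nlinarith [sq_nonneg ((a - b) - t * (a + b))]

lemma sq_div_add_le_add {a b : ℝ} (ha : 0 ≤ a) (hb : 0 ≤ b) :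
    (a - b) ^ 2 / (a + b) ≤ a + b :=
  div_le_of_le_mul₀ (add_nonneg ha hb) (add_nonneg ha hb) (by nlinarith [mul_nonneg ha hb])

lemma le_mul_triangular_add_three_mul {ι : Type*} [Fintype ι] {p q : ι → ℝ}
    (hp : ∀ a, 0 ≤ p a) (hq : ∀ a, 0 ≤ q a) {i j : ι} (hij : q i ≤ q j) :
    p i ≤ 12 * Real.sqrt 2 * ∑ a, (p a - q a) ^ 2 / (p a + q a) + 3 * p j := by
  have hterm (a : ι) : 0 ≤ (p a - q a) ^ 2 / (p a + q a) :=
    div_nonneg (sq_nonneg _) (add_nonneg (hp a) (hq a))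
  have hsum : 0 ≤ ∑ a, (p a - q a) ^ 2 / (p a + q a) := Finset.sum_nonneg fun a _ => hterm a
  have hsqrt : 1 ≤ Real.sqrt 2 := Real.one_le_sqrt.mpr one_le_two
  have hcoef : 12 * ∑ a, (p a - q a) ^ 2 / (p a + q a) ≤
      12 * Real.sqrt 2 * ∑ a, (p a - q a) ^ 2 / (p a + q a) :=
    mul_le_mul_of_nonneg_right (by linarith) hsum
  rcases eq_or_ne i j with rfl | hne
  · linarith [hp i]
  · have hpair := Finset.add_le_sum (fun a _ => hterm a) (Finset.mem_univ i)
      (Finset.mem_univ j) hne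
    linarith [two_mul_sub_le_sq_div_add (hp i) (hq i) (1 / 4),
      two_mul_sub_le_sq_div_add (hp j) (hq j) (-(2 / 5)), hp i, hp j, hq i, hq j]

/-- Intermediate self-bounding step in the proof of
Lemma `lem:triangle_selfbounding`: `L(π_f) ≤ 12√2·Δ + 3·L★`. Ratios with zero denominator
are `0` by Lean's convention `x / 0 = 0`. -/
theorem stmt_18 {X : Type*} [MeasurableSpace X] (μ : Measure X) [IsProbabilityMeasure μ]
    (K : ℕ) (hK : 1 ≤ K)
    (f fstar : X → Fin K → ℝ)
    (hfm : ∀ a, Measurable fun x => f x a) (hfsm : ∀ a, Measurable fun x => fstar x a)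
    (hf : ∀ x a, f x a ∈ Set.Icc (0:ℝ) 1) (hfs : ∀ x a, fstar x a ∈ Set.Icc (0:ℝ) 1)
    (πf πs : X → Fin K) (hπfm : Measurable πf) (hπsm : Measurable πs)
    (hπf : ∀ x a, f x (πf x) ≤ f x a) (hπs : ∀ x a, fstar x (πs x) ≤ fstar x a)
    (Lstar Δ : ℝ)
    (hLstar : Lstar = ∫ x, fstar x (πs x) ∂μ)
    (hΔ : Δ = ∫ x, ∑ a, (fstar x a - f x a) ^ 2 / (fstar x a + f x a) ∂μ) :
    (∫ x, fstar x (πf x) ∂μ) ≤ 12 * Real.sqrt 2 * Δ + 3 * Lstar := by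
  have hint {g : X → ℝ} (hg : Measurable g) (h : ∀ x, g x ∈ Set.Icc (0:ℝ) 1) :
      Integrable g μ :=
    Integrable.of_mem_Icc 0 1 hg.aemeasurable (Filter.Eventually.of_forall h)
  have hsel {π : X → Fin K} (hπ : Measurable π) : Measurable fun x => fstar x (π x) :=
    (measurable_from_prod_countable_left (f := fun z : X × Fin K => fstar z.1 z.2) hfsm).comp
      (measurable_id.prodMk hπ)
  have hD : Integrable (fun x => ∑ a, (fstar x a - f x a) ^ 2 / (fstar x a + f x a)) μ := by
    refine integrable_finsetSum _ fun a _ => ?_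
    refine Integrable.of_mem_Icc 0 2
      ((((hfsm a).sub (hfm a)).pow_const 2).div ((hfsm a).add (hfm a))).aemeasurable
      (Filter.Eventually.of_forall fun x => ⟨?_, ?_⟩)
    · exact div_nonneg (sq_nonneg _) (add_nonneg (hfs x a).1 (hf x a).1)
    · exact (sq_div_add_le_add (hfs x a).1 (hf x a).1).trans
        (by linarith [(hfs x a).2, (hf x a).2])
  have hL := hint (hsel hπsm) fun x => hfs x (πs x)
  rw [hLstar, hΔ, ← integral_const_mul, ← integral_const_mul,
    ← integral_add (hD.const_mul _) (hL.const_mul _)]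
  exact integral_mono (hint (hsel hπfm) fun x => hfs x (πf x))
    ((hD.const_mul _).add (hL.const_mul _)) fun x =>
      le_mul_triangular_add_three_mul (fun a => (hfs x a).1) (fun a => (hf x a).1)
        (hπf x (πs x))
end
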